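/- arXiv:2111.12362 — 6 statements merged into one kernel-verified Lean document; each statement's English description precedes it below -/
import Mathlib

section
/- Let G be a finite vertex- and edge-colored graph with deg(v) ≥ 3 for all v ∈ V(G), and let G′ be the edge-colored graph obtained from G by the path-attachment construction. Let u be a magic unitary over a unital C*-algebra indexed by V(G′) such that A_{G′_c} u = u A_{G′_c} for every edge color c of G′, where A_{G′_c} is the 0/1 adjacency matrix of the edges of G′ of color c. Then: (i) u_{xy} = 0 whenever x ∈ V_i and y ∈ V_j with i ≠ j; (ii) u_{v_i w_i} = u_{v_0 w_0} for all v,w ∈ V(G) and all applicable i; and (iii) u_{v_i w_i} = 0 whenever c(v) ≠ c(w), where c denotes the vertex coloring of the original graph G. -/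
open scoped BigOperators

/-- A magic unitary over a ring with star: every entry is a projection and
every row and column sums to `1`. -/
def IsMagicUnitary {I J A : Type*} [Fintype I] [Fintype J] [Ring A] [StarRing A]
    (u : I → J → A) : Prop :=
  (∀ i j, star (u i j) = u i j) ∧ (∀ i j, u i j * u i j = u i j) ∧
    (∀ i, ∑ j, u i j = 1) ∧ (∀ j, ∑ i, u i j = 1)

/-- The vertex set of the graph `G'` obtained from a graph on `Fin N` with vertex
coloring `cV` by attaching to each vertex `v` a path of length `pl (cV v)`:
the vertex `⟨v, i⟩` is the `i`-th vertex `v_i` of the path attached at `v = v_0`. -/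
abbrev PVert (N : ℕ) {CV : Type*} (cV : Fin N → CV) (pl : CV → ℕ) : Type :=
  Σ v : Fin N, Fin (pl (cV v) + 1)

/-- The edges of color `c` of the graph `G'`: the original edges of `G` of color `c`
(between the `v_0`'s), together with—when `c = c0`—the edges of the attached paths. -/
def adjP {N : ℕ} {CV CE : Type*} (adj : Fin N → Fin N → Prop)
    (ce : Fin N → Fin N → CE) (cV : Fin N → CV) (pl : CV → ℕ) (c0 : CE)
    (c : CE) (x y : PVert N cV pl) : Prop :=
  ((x.2 : ℕ) = 0 ∧ (y.2 : ℕ) = 0 ∧ adj x.1 y.1 ∧ ce x.1 y.1 = c) ∨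
    (x.1 = y.1 ∧ ((x.2 : ℕ) + 1 = (y.2 : ℕ) ∨ (y.2 : ℕ) + 1 = (x.2 : ℕ)) ∧ c = c0)

open Classical in
/-- The 0/1 adjacency matrix (entries in `A`) of the color class `c` of `G'`. -/
noncomputable def adjPMat (A : Type*) [Zero A] [One A] {N : ℕ} {CV CE : Type*}
    (adj : Fin N → Fin N → Prop) (ce : Fin N → Fin N → CE) (cV : Fin N → CV)
    (pl : CV → ℕ) (c0 : CE) (c : CE) (x y : PVert N cV pl) : A :=
  if adjP adj ce cV pl c0 c x y then 1 else 0

section BernsteinBound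

open Polynomial

/-- If `P` is a contractive idempotent commuting with `y`, and `1 + y` and `1 - y` are contractive
after multiplication by `P`, then `P * y = 0`. -/
theorem mul_eq_zero_of_norm_mul_one_add_sub_le_one {A : Type*} [NormedRing A] [NormedAlgebra ℝ A]
    {P y : A} (hP : P * P = P) (hcomm : P * y = y * P) (hP1 : ‖P‖ ≤ 1)
    (hadd : ‖P * (1 + y)‖ ≤ 1) (hsub : ‖P * (1 - y)‖ ≤ 1) : P * y = 0 := by
  have hbound : ∀ k m : ℕ, ‖P * ((1 + y) ^ k * (1 - y) ^ m)‖ ≤ 1 := by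
    intro k m
    induction k with
    | zero =>
      induction m with
      | zero => simpa using hP1
      | succ m ih =>
        have h : P * ((1 + y) ^ 0 * (1 - y) ^ (m + 1))
            = (P * (1 - y)) * (P * ((1 + y) ^ 0 * (1 - y) ^ m)) := by
          have h2 : (1 - y) * P = P * (1 - y) := by rw [mul_sub, sub_mul, hcomm]; simp
          rw [mul_assoc, ← mul_assoc (1 - y) P, h2, mul_assoc P (1 - y), ← mul_assoc P P, hP]
          simp [pow_succ']
        rw [h]
        exact (norm_mul_le _ _).trans (mul_le_one₀ hsub (norm_nonneg _) ih)
    | succ k ih =>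
      have h : P * ((1 + y) ^ (k + 1) * (1 - y) ^ m)
          = (P * (1 + y)) * (P * ((1 + y) ^ k * (1 - y) ^ m)) := by
        have h2 : (1 + y) * P = P * (1 + y) := by rw [mul_add, add_mul, hcomm]; simp
        rw [mul_assoc, ← mul_assoc (1 + y) P, h2, mul_assoc P (1 + y), ← mul_assoc P P, hP,
          pow_succ', mul_assoc (1 + y)]
      rw [h]
      exact (norm_mul_le _ _).trans (mul_le_one₀ hadd (norm_nonneg _) ih)
  set x : A := (1 / 2 : ℝ) • (1 + y) with hx
  have hx1 : 1 - x = (1 / 2 : ℝ) • (1 - y) := by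
    rw [hx]
    module
  have hB : ∀ n ν : ℕ, ν ≤ n →
      ‖P * aeval x (bernsteinPolynomial ℝ n ν)‖ ≤ (bernsteinPolynomial ℝ n ν).eval (1 / 2) := by
    intro n ν hν
    have h1 : P * aeval x (bernsteinPolynomial ℝ n ν)
        = ((n.choose ν : ℝ) * (1 / 2) ^ ν * (1 / 2) ^ (n - ν)) •
          (P * ((1 + y) ^ ν * (1 - y) ^ (n - ν))) := by
      simp only [bernsteinPolynomial, map_mul, map_natCast, map_pow, aeval_X, map_sub, map_one, hx1]
      rw [hx, _root_.smul_pow, _root_.smul_pow, ← nsmul_eq_mul, ← Nat.cast_smul_eq_nsmul ℝ]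
      simp only [smul_mul_assoc, mul_smul_comm, smul_smul]
      congr 1
      ring
    have h2 : (bernsteinPolynomial ℝ n ν).eval (1 / 2)
        = (n.choose ν : ℝ) * (1 / 2) ^ ν * (1 / 2) ^ (n - ν) := by
      have h3 : (1 : ℝ) - 1 / 2 = 1 / 2 := by norm_num
      simp only [bernsteinPolynomial, eval_mul, eval_natCast, eval_pow, eval_X, eval_sub, eval_one,
        h3]
    rw [h1, h2, norm_smul, Real.norm_of_nonneg (by positivity)]
    exact mul_le_of_le_one_right (by positivity) (hbound _ _)
  have hBnn : ∀ n ν : ℕ, 0 ≤ (bernsteinPolynomial ℝ n ν).eval (1 / 2) := by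
    intro n ν
    simp only [bernsteinPolynomial, eval_mul, eval_natCast, eval_pow, eval_X, eval_sub, eval_one]
    positivity
  have hB1 : ∀ n : ℕ, ∑ ν ∈ Finset.range (n + 1), (bernsteinPolynomial ℝ n ν).eval (1 / 2) = 1 := by
    intro n
    rw [← eval_finsetSum, bernsteinPolynomial.sum, eval_one]
  have hBv : ∀ n : ℕ, ∑ ν ∈ Finset.range (n + 1),
      (2 * (ν : ℝ) - n) ^ 2 * (bernsteinPolynomial ℝ n ν).eval (1 / 2) = (n : ℝ) := by
    intro n
    have h := congrArg (fun q : ℝ[X] => 4 * q.eval (1 / 2)) (bernsteinPolynomial.variance ℝ n)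
    simp only [eval_finsetSum, eval_mul, eval_pow, eval_sub, eval_X, eval_natCast,
      eval_one, nsmul_eq_mul, Finset.mul_sum] at h
    refine (Finset.sum_congr rfl fun ν _ => ?_).trans (h.trans ?_) <;> ring
  have hsum : ∀ n : ℕ, ∑ ν ∈ Finset.range (n + 1),
      (2 * (ν : ℝ) - n) • (P * aeval x (bernsteinPolynomial ℝ n ν)) = (n : ℝ) • (P * y) := by
    intro n
    have h := congrArg (fun q : ℝ[X] => P * aeval x q) (bernsteinPolynomial.sum_smul ℝ n)
    have h' := congrArg (fun q : ℝ[X] => P * aeval x q) (bernsteinPolynomial.sum ℝ n)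
    simp only [map_sum, map_nsmul, aeval_X, map_one, Finset.mul_sum, mul_smul_comm] at h h'
    simp only [sub_smul, mul_smul, Finset.sum_sub_distrib, ← Finset.smul_sum]
    simp only [Nat.cast_smul_eq_nsmul ℝ]
    rw [h, h', hx, mul_smul_comm, mul_add, ← Nat.cast_smul_eq_nsmul ℝ, ← Nat.cast_smul_eq_nsmul ℝ,
      ← Nat.cast_smul_eq_nsmul ℝ]
    module
  have hle : ∀ n : ℕ, (n : ℝ) * ‖P * y‖ ^ 2 ≤ 1 := by
    intro n
    rcases Nat.eq_zero_or_pos n with rfl | hn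
    · simp
    have hn' : (0 : ℝ) < n := by exact_mod_cast hn
    have h1 : (n : ℝ) * ‖P * y‖ ≤ ∑ ν ∈ Finset.range (n + 1),
        |2 * (ν : ℝ) - n| * (bernsteinPolynomial ℝ n ν).eval (1 / 2) := by
      have : (n : ℝ) * ‖P * y‖ = ‖(n : ℝ) • (P * y)‖ := by
        rw [norm_smul, Real.norm_of_nonneg hn'.le]
      rw [this, ← hsum n]
      refine (norm_sum_le _ _).trans (Finset.sum_le_sum fun ν hν => ?_)
      rw [norm_smul, Real.norm_eq_abs]
      exact mul_le_mul_of_nonneg_left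
        (hB n ν (Nat.lt_succ_iff.mp (Finset.mem_range.mp hν))) (abs_nonneg _)
    have h2 : (∑ ν ∈ Finset.range (n + 1),
        |2 * (ν : ℝ) - n| * (bernsteinPolynomial ℝ n ν).eval (1 / 2)) ^ 2 ≤ n := by
      refine (Finset.sum_sq_le_sum_mul_sum_of_sq_le_mul (Finset.range (n + 1))
        (f := fun ν => (2 * (ν : ℝ) - n) ^ 2 * (bernsteinPolynomial ℝ n ν).eval (1 / 2))
        (g := fun ν => (bernsteinPolynomial ℝ n ν).eval (1 / 2))
        (fun ν _ => mul_nonneg (sq_nonneg _) (hBnn n ν)) (fun ν _ => hBnn n ν)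
        (fun ν _ => ?_)).trans ?_
      · rw [mul_pow, sq_abs]; exact le_of_eq (by ring)
      · rw [hBv, hB1, mul_one]
    have h3 : ((n : ℝ) * ‖P * y‖) ^ 2 ≤ n := (pow_le_pow_left₀ (by positivity) h1 2).trans h2
    have h4 : (n : ℝ) * ((n : ℝ) * ‖P * y‖ ^ 2) ≤ n * 1 := by
      rw [mul_one]; calc _ = ((n : ℝ) * ‖P * y‖) ^ 2 := by ring
        _ ≤ n := h3
    exact le_of_mul_le_mul_left h4 hn'
  by_contra hne
  have hpos : 0 < ‖P * y‖ ^ 2 := by positivity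
  obtain ⟨n, hn⟩ := exists_nat_gt (1 / ‖P * y‖ ^ 2)
  rw [div_lt_iff₀ hpos] at hn
  exact absurd (hle n) (not_le.mpr hn)

end BernsteinBound

/-- Projections summing to `1` are pairwise orthogonal. The involution is not assumed to be
conjugate-linear. -/
theorem mul_eq_zero_of_sum_projections_eq_one {ι A : Type*} [Fintype ι] [NormedRing A]
    [StarRing A] [CStarRing A] [NormedAlgebra ℝ A] {p : ι → A} (hstar : ∀ i, star (p i) = p i)
    (hidem : ∀ i, p i * p i = p i) (hsum : ∑ i, p i = 1) {i j : ι} (hij : i ≠ j) :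
    p i * p j = 0 := by
  classical
  have hnorm_le : ∀ a : A, star a * a = a → ‖a‖ ≤ 1 := by
    intro a ha
    have h := CStarRing.norm_star_mul_self (x := a)
    rw [ha] at h
    by_contra hlt
    nlinarith [not_le.mp hlt]
  have h1 : ‖(1 : A)‖ ≤ 1 := hnorm_le 1 (by simp)
  have hp1 : ∀ k, ‖p k‖ ≤ 1 := fun k => hnorm_le _ (by rw [hstar, hidem])
  have hrefl : ∀ k, ‖1 - (2 : ℝ) • p k‖ ≤ 1 := by
    intro k
    have h := CStarRing.norm_star_mul_self (x := 1 - (2 : ℝ) • p k)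
    have h2 : star (1 - (2 : ℝ) • p k) * (1 - (2 : ℝ) • p k) = 1 := by
      rw [two_smul, star_sub, star_add, star_one, hstar]
      simp only [sub_mul, mul_sub, add_mul, mul_add, hidem, one_mul, mul_one]
      abel
    rw [h2] at h
    nlinarith [norm_nonneg (1 - (2 : ℝ) • p k)]
  have hconv : ∀ (K : Finset ι) (s : ℝ), 0 ≤ s → s * K.card ≤ 2 →
      ‖1 - s • ∑ k ∈ K, p k‖ ≤ 1 := by
    intro K s hs hK
    have h : 1 - s • ∑ k ∈ K, p k
        = (1 - s * K.card / 2) • (1 : A) + ∑ k ∈ K, (s / 2) • (1 - (2 : ℝ) • p k) := by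
      simp only [smul_sub, Finset.sum_sub_distrib, Finset.sum_const, smul_smul, Finset.smul_sum]
      rw [← Nat.cast_smul_eq_nsmul ℝ]
      have : s / 2 * 2 = s := by ring
      rw [this]
      module
    rw [h]
    refine (norm_add_le _ _).trans ?_
    have ha : ‖(1 - s * K.card / 2) • (1 : A)‖ ≤ 1 - s * K.card / 2 := by
      rw [norm_smul, Real.norm_of_nonneg (by linarith)]
      exact mul_le_of_le_one_right (by linarith) h1
    have hb : ‖∑ k ∈ K, (s / 2) • (1 - (2 : ℝ) • p k)‖ ≤ K.card * (s / 2) := by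
      refine (norm_sum_le_of_le K (f := fun k => (s / 2) • (1 - (2 : ℝ) • p k))
        (n := fun _ => s / 2) fun k _ => ?_).trans (by simp)
      rw [norm_smul, Real.norm_of_nonneg (by linarith)]
      exact mul_le_of_le_one_right (by linarith) (hrefl k)
    linarith
  have hcompress : ∀ a : A, ‖a‖ ≤ 1 → ‖p j * a * p j‖ ≤ 1 := fun a ha =>
    (norm_mul_le _ _).trans (mul_le_one₀
      ((norm_mul_le _ _).trans (mul_le_one₀ (hp1 j) (norm_nonneg _) ha)) (norm_nonneg _) (hp1 j))
  set s : ℝ := 1 / Fintype.card ι with hs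
  have hcard : 0 < (Fintype.card ι : ℝ) := by
    exact_mod_cast Fintype.card_pos_iff.mpr ⟨i⟩
  have hs0 : 0 < s := by positivity
  have hsK : ∀ K : Finset ι, s * K.card ≤ 2 := by
    intro K
    have h : (K.card : ℝ) ≤ Fintype.card ι := by exact_mod_cast Finset.card_le_univ K
    have h' : s * K.card ≤ 1 := by
      rw [hs, one_div, inv_mul_le_iff₀ hcard]; linarith
    linarith
  have hsplit : p j + (p i + ∑ k ∈ (Finset.univ.erase j).erase i, p k) = 1 := by
    rw [Finset.add_sum_erase _ _ (Finset.mem_erase.mpr ⟨hij, Finset.mem_univ i⟩),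
      Finset.add_sum_erase _ _ (Finset.mem_univ j), hsum]
  have hzero : p j * p i * p j + p j * (∑ k ∈ (Finset.univ.erase j).erase i, p k) * p j = 0 := by
    have h := congrArg (fun a => p j * a * p j) hsplit
    simp only [mul_add, add_mul, hidem, mul_one] at h
    exact left_eq_add.mp h.symm
  have key : p j * (s • (p j * p i * p j)) = 0 := by
    refine mul_eq_zero_of_norm_mul_one_add_sub_le_one (hidem j) ?_ (hp1 j) ?_ ?_
    · rw [mul_smul_comm, smul_mul_assoc, mul_assoc _ (p j) (p j), hidem, ← mul_assoc (p j),
        ← mul_assoc (p j), hidem]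
    · have h : p j * (1 + s • (p j * p i * p j))
          = p j * (1 - s • ∑ k ∈ (Finset.univ.erase j).erase i, p k) * p j := by
        rw [eq_neg_of_add_eq_zero_left hzero]
        simp only [mul_add, mul_sub, sub_mul, mul_one, mul_smul_comm, smul_mul_assoc, smul_neg,
          mul_neg, hidem, ← mul_assoc]
        abel
      rw [h]
      exact hcompress _ (hconv _ s hs0.le (hsK _))
    · have h : p j * (1 - s • (p j * p i * p j))
          = p j * (1 - s • ∑ k ∈ {i}, p k) * p j := by
        simp only [Finset.sum_singleton, mul_sub, sub_mul, mul_one, mul_smul_comm, smul_mul_assoc,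
          hidem, ← mul_assoc]
      rw [h]
      exact hcompress _ (hconv _ s hs0.le (hsK _))
  rw [mul_smul_comm, ← mul_assoc, ← mul_assoc, hidem] at key
  have hz : p j * p i * p j = 0 := (smul_eq_zero.mp key).resolve_left hs0.ne'
  rw [← CStarRing.star_mul_self_eq_zero_iff, star_mul, hstar, hstar, mul_assoc, ← mul_assoc (p i),
    hidem, ← mul_assoc, hz]

/-- If a magic unitary `u` commutes with the `0`/`1` matrix of a relation `R`, then
`u x y * u x' y'` vanishes unless `R x x'` and `R y y'` are equivalent. -/
theorem IsMagicUnitary.mul_eq_zero_of_not_iff {I A : Type*} [Fintype I] [NormedRing A]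
    [StarRing A] [CStarRing A] [NormedAlgebra ℝ A] {u : I → I → A} (hu : IsMagicUnitary u)
    {M : I → I → A} {R : I → I → Prop} (hM1 : ∀ x y, R x y → M x y = 1)
    (hM0 : ∀ x y, ¬ R x y → M x y = 0)
    (hcomm : ∀ x y, (∑ z, M x z * u z y) = ∑ z, u x z * M z y)
    {x y x' y' : I} (h : ¬ (R x x' ↔ R y y')) : u x y * u x' y' = 0 := by
  classical
  obtain ⟨hstar, hidem, hrow, hcol⟩ := hu
  have hr : ∀ a b c, b ≠ c → u a b * u a c = 0 := fun a b c hbc =>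
    mul_eq_zero_of_sum_projections_eq_one (hstar a) (hidem a) (hrow a) hbc
  have hc : ∀ a b c, a ≠ b → u a c * u b c = 0 := fun a b c hab =>
    mul_eq_zero_of_sum_projections_eq_one (p := fun k => u k c) (hstar · c) (hidem · c) (hcol c) hab
  have hMcomm : ∀ a b (d : A), d * M a b = M a b * d := by
    intro a b d
    by_cases hab : R a b
    · simp [hM1 _ _ hab]
    · simp [hM0 _ _ hab]
  have h1 := congrArg (fun a => u x y * a * u x' y') (hcomm x y')
  simp only [Finset.mul_sum, Finset.sum_mul] at h1
  rw [Finset.sum_eq_single x' ?_ (by simp), Finset.sum_eq_single y ?_ (by simp)] at h1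
  · rw [← mul_assoc (u x y) (M x x'), hMcomm, mul_assoc (M x x'), mul_assoc (M x x'), mul_assoc (u x y),
      hidem, hMcomm y y', ← mul_assoc (u x y) (M y y'), hMcomm y y', mul_assoc (M y y'), hidem,
      mul_assoc (M y y')] at h1
    by_cases ha : R x x' <;> by_cases hb : R y y'
    · exact absurd (iff_of_true ha hb) h
    · simpa [hM1 _ _ ha, hM0 _ _ hb] using h1
    · simpa [hM0 _ _ ha, hM1 _ _ hb] using h1.symm
    · exact absurd (iff_of_false ha hb) h
  · intro z _ hz
    rw [← mul_assoc (u x y), hr x y z hz.symm]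
    simp
  · intro z _ hz
    rw [mul_assoc, mul_assoc, hc z x' y' hz]
    simp

/-- Let `R` be a relation such that `u x y * u x' y' = 0` unless `R x x' ↔ R y y'`. If some
`R`-neighbour `x'` of `x` has `u x' y' = 0` for all `R`-neighbours `y'` of `y`, then
`u x y = 0`. -/
theorem eq_zero_of_forall_adj_eq_zero {I A : Type*} [Fintype I] [Ring A] {u : I → I → A}
    (hrow : ∀ x, ∑ y, u x y = 1) {R : I → I → Prop}
    (hR : ∀ x y x' y', ¬ (R x x' ↔ R y y') → u x y * u x' y' = 0)
    {x y x' : I} (hx : R x x') (h : ∀ y', R y y' → u x' y' = 0) : u x y = 0 := by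
  rw [← mul_one (u x y), ← hrow x', Finset.mul_sum]
  refine Finset.sum_eq_zero fun y' _ => ?_
  by_cases hy : R y y'
  · rw [h y' hy, mul_zero]
  · exact hR _ _ _ _ (by tauto)

open Classical in
/-- Entries of `u` between vertices of different degrees vanish. -/
theorem eq_zero_of_card_adj_ne {I A : Type*} [Fintype I] [Ring A] [Algebra ℝ A] {u : I → I → A}
    (hrow : ∀ x, ∑ y, u x y = 1) (hcol : ∀ y, ∑ x, u x y = 1) {R : I → I → Prop}
    (hR : ∀ x y x' y', ¬ (R x x' ↔ R y y') → u x y * u x' y' = 0) {x y : I}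
    (h : (Finset.univ.filter (R x)).card ≠ (Finset.univ.filter (R y)).card) : u x y = 0 := by
  have h1 : ∑ x' with R x x', ∑ y', u x y * u x' y'
      = ∑ x' with R x x', ∑ y' with R y y', u x y * u x' y' := by
    refine Finset.sum_congr rfl fun x' hx' => ?_
    rw [Finset.sum_filter]
    refine Finset.sum_congr rfl fun y' _ => ?_
    split_ifs with hy
    · rfl
    · exact hR _ _ _ _ (by simp_all)
  have h2 : ∑ y' with R y y', ∑ x', u x y * u x' y'
      = ∑ y' with R y y', ∑ x' with R x x', u x y * u x' y' := by
    refine Finset.sum_congr rfl fun y' hy' => ?_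
    rw [Finset.sum_filter]
    refine Finset.sum_congr rfl fun x' _ => ?_
    split_ifs with hx
    · rfl
    · exact hR _ _ _ _ (by simp_all)
  rw [Finset.sum_comm (s := Finset.univ.filter (R y)) (t := Finset.univ.filter (R x)), ← h1] at h2
  simp only [← Finset.mul_sum, hrow, hcol, mul_one, Finset.sum_const] at h2
  rw [← Nat.cast_smul_eq_nsmul ℝ, ← Nat.cast_smul_eq_nsmul ℝ, ← sub_eq_zero, ← sub_smul] at h2
  refine (smul_eq_zero.mp h2).resolve_left ?_
  exact sub_ne_zero.mpr (by exact_mod_cast h.symm)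

/-- Adjacency in `G'`, regardless of colors. -/
def pathAdj {N : ℕ} {CV : Type*} (adj : Fin N → Fin N → Prop) (cV : Fin N → CV) (pl : CV → ℕ)
    (x y : PVert N cV pl) : Prop :=
  ((x.2 : ℕ) = 0 ∧ (y.2 : ℕ) = 0 ∧ adj x.1 y.1) ∨
    (x.1 = y.1 ∧ ((x.2 : ℕ) + 1 = (y.2 : ℕ) ∨ (y.2 : ℕ) + 1 = (x.2 : ℕ)))

section PathBlocks

variable {N : ℕ} {CV A : Type*} {adj : Fin N → Fin N → Prop} {cV : Fin N → CV} {pl : CV → ℕ}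

open Classical in
theorem card_pathAdj_le_two {x : PVert N cV pl} (hx : (x.2 : ℕ) ≠ 0) :
    (Finset.univ.filter (pathAdj adj cV pl x)).card ≤ 2 := by
  calc _ ≤ ({(x.2 : ℕ) - 1, (x.2 : ℕ) + 1} : Finset ℕ).card := ?_
    _ ≤ 2 := Finset.card_le_two
  refine Finset.card_le_card_of_injOn (fun y => (y.2 : ℕ)) ?_ ?_
  · intro y hy
    simp only [Finset.coe_filter, Finset.mem_univ, true_and, Set.mem_ofPred_eq, pathAdj, hx,
      false_and, false_or] at hy
    simp only [Finset.coe_insert, Finset.coe_singleton, Set.mem_insert_iff, Set.mem_singleton_iff]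
    omega
  · rintro ⟨v, i⟩ hv ⟨w, j⟩ hw hvw
    simp only [Finset.coe_filter, Finset.mem_univ, true_and, Set.mem_ofPred_eq, pathAdj, hx,
      false_and, false_or] at hv hw
    obtain rfl : v = w := hv.1.symm.trans hw.1
    simpa [Fin.ext_iff] using hvw

open Classical in
theorem three_le_card_pathAdj [DecidableRel adj] {x : PVert N cV pl}
    (hdeg : ∀ v : Fin N, 3 ≤ (Finset.univ.filter fun w => adj v w).card) (hx : (x.2 : ℕ) = 0) :
    3 ≤ (Finset.univ.filter (pathAdj adj cV pl x)).card := by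
  refine (hdeg x.1).trans (Finset.card_le_card_of_injOn (fun w => ⟨w, 0⟩) ?_ ?_)
  · intro w hw
    simp only [Finset.coe_filter, Finset.mem_univ, true_and, Set.mem_ofPred_eq] at hw ⊢
    exact Or.inl ⟨hx, rfl, hw⟩
  · intro v _ w _ h
    exact congrArg Sigma.fst h

variable [Ring A] {u : PVert N cV pl → PVert N cV pl → A}

theorem eq_zero_of_path_index_lt [Algebra ℝ A] [DecidableRel adj]
    (hdeg : ∀ v : Fin N, 3 ≤ (Finset.univ.filter fun w => adj v w).card)
    (hrow : ∀ x, ∑ y, u x y = 1) (hcol : ∀ y, ∑ x, u x y = 1)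
    (hR : ∀ x y x' y', ¬ (pathAdj adj cV pl x x' ↔ pathAdj adj cV pl y y') →
      u x y * u x' y' = 0) :
    ∀ (i : ℕ) (x y : PVert N cV pl), (x.2 : ℕ) = i → i < (y.2 : ℕ) → u x y = 0 := by
  intro i
  induction i with
  | zero =>
    intro x y hx hy
    refine eq_zero_of_card_adj_ne hrow hcol hR ?_
    have h1 := three_le_card_pathAdj hdeg hx
    have h2 := card_pathAdj_le_two (adj := adj) (x := y) (by omega)
    omega
  | succ i ih =>
    rintro ⟨v, k, hk⟩ y hx hy
    simp only at hx
    subst hx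
    refine eq_zero_of_forall_adj_eq_zero hrow hR (x' := ⟨v, i, by omega⟩)
      (Or.inr ⟨rfl, Or.inr rfl⟩) fun y' hy' => ih _ _ rfl ?_
    rcases hy' with h | h <;> omega

theorem path_entry_eq_of_succ
    (hrow : ∀ x, ∑ y, u x y = 1)
    (hR : ∀ x y x' y', ¬ (pathAdj adj cV pl x x' ↔ pathAdj adj cV pl y y') →
      u x y * u x' y' = 0)
    (hne : ∀ x y : PVert N cV pl, (x.2 : ℕ) ≠ (y.2 : ℕ) → u x y = 0)
    (v w : Fin N) (i : ℕ) (hv : i + 1 < pl (cV v) + 1) (hw : i + 1 < pl (cV w) + 1) :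
    u ⟨v, i + 1, hv⟩ ⟨w, i + 1, hw⟩ = u ⟨v, i, by omega⟩ ⟨w, i, by omega⟩ := by
  have h1 : u ⟨v, i + 1, hv⟩ ⟨w, i + 1, hw⟩
      = u ⟨v, i + 1, hv⟩ ⟨w, i + 1, hw⟩ * u ⟨v, i, by omega⟩ ⟨w, i, by omega⟩ := by
    conv_lhs => rw [← mul_one (u _ _), ← hrow ⟨v, i, by omega⟩, Finset.mul_sum]
    refine Finset.sum_eq_single _ ?_ (by simp)
    rintro ⟨w', k, hk⟩ _ hne'
    by_cases hki : i = k
    · subst hki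
      refine hR _ _ _ _ ?_
      have hL : pathAdj adj cV pl ⟨v, i + 1, hv⟩ ⟨v, i, by omega⟩ := Or.inr ⟨rfl, Or.inr rfl⟩
      simp only [hL, true_iff]
      rintro (h | h)
      · simp at h
      · obtain rfl : w = w' := h.1
        exact hne' rfl
    · rw [hne ⟨v, i, by omega⟩ ⟨w', k, hk⟩ hki, mul_zero]
  have h2 : u ⟨v, i, by omega⟩ ⟨w, i, by omega⟩
      = u ⟨v, i + 1, hv⟩ ⟨w, i + 1, hw⟩ * u ⟨v, i, by omega⟩ ⟨w, i, by omega⟩ := by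
    conv_lhs => rw [← one_mul (u _ _), ← hrow ⟨v, i + 1, hv⟩, Finset.sum_mul]
    refine Finset.sum_eq_single _ ?_ (by simp)
    rintro ⟨w', k, hk⟩ _ hne'
    by_cases hki : i + 1 = k
    · subst hki
      refine hR _ _ _ _ ?_
      have hL : pathAdj adj cV pl ⟨v, i + 1, hv⟩ ⟨v, i, by omega⟩ := Or.inr ⟨rfl, Or.inr rfl⟩
      simp only [hL, true_iff]
      rintro (h | h)
      · simp at h
      · obtain rfl : w' = w := h.1
        exact hne' rfl
    · rw [hne ⟨v, i + 1, hv⟩ ⟨w', k, hk⟩ hki, zero_mul]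
  exact h1.trans h2.symm

theorem path_entry_eq
    (hrow : ∀ x, ∑ y, u x y = 1)
    (hR : ∀ x y x' y', ¬ (pathAdj adj cV pl x x' ↔ pathAdj adj cV pl y y') →
      u x y * u x' y' = 0)
    (hne : ∀ x y : PVert N cV pl, (x.2 : ℕ) ≠ (y.2 : ℕ) → u x y = 0)
    (v w : Fin N) (i : ℕ) (hv : i < pl (cV v) + 1) (hw : i < pl (cV w) + 1) :
    u ⟨v, i, hv⟩ ⟨w, i, hw⟩ = u ⟨v, 0⟩ ⟨w, 0⟩ := by
  induction i with
  | zero => rfl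
  | succ i ih => rw [path_entry_eq_of_succ hrow hR hne, ih]

theorem base_entry_eq_zero_of_length_lt
    (hrow : ∀ x, ∑ y, u x y = 1)
    (hR : ∀ x y x' y', ¬ (pathAdj adj cV pl x x' ↔ pathAdj adj cV pl y y') →
      u x y * u x' y' = 0)
    (hne : ∀ x y : PVert N cV pl, (x.2 : ℕ) ≠ (y.2 : ℕ) → u x y = 0)
    {v w : Fin N} (h : pl (cV w) < pl (cV v)) : u ⟨v, 0⟩ ⟨w, 0⟩ = 0 := by
  rw [← path_entry_eq hrow hR hne v w (pl (cV w)) (by omega) (by omega)]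
  refine eq_zero_of_forall_adj_eq_zero hrow hR (x' := ⟨v, pl (cV w) + 1, by omega⟩)
    (Or.inr ⟨rfl, Or.inl rfl⟩) ?_
  rintro ⟨w', k, hk⟩ hy
  refine hne _ _ ?_
  rcases hy with h | ⟨rfl, h⟩
  · simp only at h ⊢
    omega
  · have hk' : k < pl (cV w) + 1 := hk
    simp only at h ⊢
    omega

end PathBlocks

/-- Lemma 4.5: let `G` be a finite vertex- and edge-colored graph (vertex coloring `cV`,
edge coloring `ce` on the symmetric irreflexive adjacency `adj`) with all degrees at
least 3, and let `G'` be obtained by attaching paths of pairwise distinct lengths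
`pl (cV v)` (path edges colored `c0`). If `u` is a magic unitary commuting with all
edge-color adjacency matrices of `G'`, then (i) `u_{v_i w_j} = 0` for `i ≠ j`;
(ii) `u_{v_i w_i} = u_{v_0 w_0}`; (iii) `u_{v_i w_i} = 0` whenever `cV v ≠ cV w`. -/
theorem pathAttachedBlockStructure
    {N : ℕ} {CV CE A : Type*}
    [NormedRing A] [StarRing A] [CStarRing A] [NormedAlgebra ℂ A] [CompleteSpace A]
    (adj : Fin N → Fin N → Prop) [DecidableRel adj]
    (hsymm : ∀ v w, adj v w → adj w v) (hirr : ∀ v, ¬ adj v v)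
    (ce : Fin N → Fin N → CE) (hce : ∀ v w, ce v w = ce w v)
    (cV : Fin N → CV) (pl : CV → ℕ) (hpl : Function.Injective pl) (c0 : CE)
    (hdeg : ∀ v : Fin N, 3 ≤ (Finset.univ.filter fun w => adj v w).card)
    (u : PVert N cV pl → PVert N cV pl → A) (hmu : IsMagicUnitary u)
    (hcomm : ∀ (c : CE) (x y : PVert N cV pl),
      (∑ z, adjPMat A adj ce cV pl c0 c x z * u z y)
        = ∑ z, u x z * adjPMat A adj ce cV pl c0 c z y) :
    (∀ x y : PVert N cV pl, (x.2 : ℕ) ≠ (y.2 : ℕ) → u x y = 0) ∧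
    (∀ (v w : Fin N) (i : Fin (pl (cV v) + 1)) (j : Fin (pl (cV w) + 1)),
      (i : ℕ) = (j : ℕ) → u ⟨v, i⟩ ⟨w, j⟩ = u ⟨v, 0⟩ ⟨w, 0⟩) ∧
    (∀ (v w : Fin N) (i : Fin (pl (cV v) + 1)) (j : Fin (pl (cV w) + 1)),
      (i : ℕ) = (j : ℕ) → cV v ≠ cV w → u ⟨v, i⟩ ⟨w, j⟩ = 0) := by
  obtain ⟨-, -, hrow, hcol⟩ := id hmu
  have hR : ∀ x y x' y', ¬ (pathAdj adj cV pl x x' ↔ pathAdj adj cV pl y y') →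
      u x y * u x' y' = 0 := by
    intro x y x' y' h
    have hcolor : ∀ c, ¬ (adjP adj ce cV pl c0 c x x' ↔ adjP adj ce cV pl c0 c y y') →
        u x y * u x' y' = 0 := fun c =>
      hmu.mul_eq_zero_of_not_iff (M := adjPMat A adj ce cV pl c0 c)
        (fun _ _ h => if_pos h) (fun _ _ h => if_neg h) (hcomm c)
    have hle : ∀ c a b, adjP adj ce cV pl c0 c a b → pathAdj adj cV pl a b := by
      rintro c a b (h | h)
      · exact Or.inl ⟨h.1, h.2.1, h.2.2.1⟩
      · exact Or.inr ⟨h.1, h.2.1⟩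
    have hex : ∀ a b, pathAdj adj cV pl a b → ∃ c, adjP adj ce cV pl c0 c a b := by
      rintro a b (h | h)
      · exact ⟨_, Or.inl ⟨h.1, h.2.1, h.2.2, rfl⟩⟩
      · exact ⟨_, Or.inr ⟨h.1, h.2, rfl⟩⟩
    by_cases hx : pathAdj adj cV pl x x'
    · obtain ⟨c, hc⟩ := hex _ _ hx
      exact hcolor c fun hi => h (iff_of_true hx (hle _ _ _ (hi.mp hc)))
    · have hy : pathAdj adj cV pl y y' := by
        by_contra hy
        exact h (iff_of_false hx hy)
      obtain ⟨c, hc⟩ := hex _ _ hy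
      exact hcolor c fun hi => hx (hle _ _ _ (hi.mpr hc))
  have hRt : ∀ x y x' y', ¬ (pathAdj adj cV pl x x' ↔ pathAdj adj cV pl y y') →
      u y x * u y' x' = 0 := fun x y x' y' h => hR _ _ _ _ fun hi => h hi.symm
  have hne : ∀ x y : PVert N cV pl, (x.2 : ℕ) ≠ (y.2 : ℕ) → u x y = 0 := by
    intro x y hxy
    rcases lt_or_gt_of_ne hxy with h | h
    · exact eq_zero_of_path_index_lt hdeg hrow hcol hR _ x y rfl h
    · exact eq_zero_of_path_index_lt (u := fun a b => u b a) hdeg hcol hrow hRt _ y x rfl h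
  have heq : ∀ (v w : Fin N) (i : Fin (pl (cV v) + 1)) (j : Fin (pl (cV w) + 1)),
      (i : ℕ) = (j : ℕ) → u ⟨v, i⟩ ⟨w, j⟩ = u ⟨v, 0⟩ ⟨w, 0⟩ := by
    rintro v w ⟨i, hi⟩ ⟨j, hj⟩ hij
    obtain rfl : i = j := hij
    exact path_entry_eq hrow hR hne v w i hi hj
  refine ⟨hne, heq, fun v w i j hij hc => ?_⟩
  rw [heq v w i j hij]
  rcases lt_or_gt_of_ne (hpl.ne hc) with h | h
  · exact base_entry_eq_zero_of_length_lt (u := fun a b => u b a) hcol hRt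
      (fun x y hxy => hne y x hxy.symm) h
  · exact base_entry_eq_zero_of_length_lt hrow hR hne h
end

section
/- Let G be a finite vertex- and edge-colored graph and let G′ be the edge-colored graph obtained from G by the path-attachment construction. Let w be a magic unitary over a unital C*-algebra indexed by V(G) satisfying the Qut(G) relations. Define the matrix w′ indexed by V(G′) by w′_{v_i w_j} = 0 if i ≠ j and w′_{v_i w_i} = w_{vw} for all applicable indices (this is well defined since w_{vw} = 0 unless v and w have the same vertex color, in which case their attached paths have the same length). Then w′ is a magic unitary and A_{G′_c} w′ = w′ A_{G′_c} for every edge color c of G′, where A_{G′_c} is the 0/1 adjacency matrix of the edges of G′ of color c. -/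
open scoped BigOperators

open Classical in
/-- The 0/1 adjacency matrix (entries in `A`) of the color class `c` of the original
colored graph `G` (adjacency `adj`, edge coloring `ce`). -/
noncomputable def adjGMat (A : Type*) [Zero A] [One A] {N : ℕ} {CE : Type*}
    (adj : Fin N → Fin N → Prop) (ce : Fin N → Fin N → CE) (c : CE)
    (v w : Fin N) : A :=
  if adj v w ∧ ce v w = c then 1 else 0

/-- Summing over the `j`-th path vertices amounts to summing over the vertices of `G`, when the
summand vanishes at the vertices whose attached path is too short. -/
lemma sum_pVert_level {N : ℕ} {CV A : Type*} [AddCommMonoid A] (cV : Fin N → CV) (pl : CV → ℕ)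
    (j : ℕ) (f : Fin N → A) (hf : ∀ a, pl (cV a) < j → f a = 0) :
    ∑ z : PVert N cV pl, (if (z.2 : ℕ) = j then f z.1 else 0) = ∑ a, f a := by
  rw [Fintype.sum_sigma]
  refine Finset.sum_congr rfl fun a _ => ?_
  rw [Fin.sum_univ_eq_sum_range (fun k => if k = j then f a else 0) (pl (cV a) + 1),
    Finset.sum_ite_eq' (Finset.range (pl (cV a) + 1)) j (fun _ => f a)]
  split_ifs with h
  · rfl
  · exact (hf a (by simpa [Nat.lt_succ_iff] using h)).symm

open Classical in
/-- The adjacency matrix of a color class of `G'` is the sum of the contribution of `G` and that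
of the attached paths. -/
lemma adjPMat_eq_add (A : Type*) [NonAssocSemiring A] {N : ℕ} {CV CE : Type*}
    (adj : Fin N → Fin N → Prop) (ce : Fin N → Fin N → CE) (cV : Fin N → CV)
    (pl : CV → ℕ) (c0 c : CE) (x y : PVert N cV pl) :
    adjPMat A adj ce cV pl c0 c x y =
      (if (x.2 : ℕ) = 0 ∧ (y.2 : ℕ) = 0 then adjGMat A adj ce c x.1 y.1 else 0) +
      (if x.1 = y.1 then
        if ((x.2 : ℕ) + 1 = (y.2 : ℕ) ∨ (y.2 : ℕ) + 1 = (x.2 : ℕ)) ∧ c = c0 then 1 else 0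
        else 0) := by
  unfold adjPMat adjP adjGMat
  by_cases h : (x.2 : ℕ) = 0 ∧ (y.2 : ℕ) = 0
  · simp [h.1, h.2]
  · have h' : ¬((x.2 : ℕ) = 0 ∧ (y.2 : ℕ) = 0 ∧ adj x.1 y.1 ∧ ce x.1 y.1 = c) :=
      fun H => h ⟨H.1, H.2.1⟩
    simp only [h, h', if_false, false_or, zero_add, ite_and]

/-- Second half of Theorem 4.6: a magic unitary `w` satisfying the `Qut(G)` relations of
the vertex- and edge-colored graph `G` extends to the magic unitary
`w'_{v_i w_j} = δ_{ij} w_{vw}` on `G'`, which commutes with all edge-color adjacency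
matrices of `G'`. -/
theorem pathAttachedExtension
    {N : ℕ} {CV CE A : Type*}
    [NormedRing A] [StarRing A] [CStarRing A] [NormedAlgebra ℂ A] [CompleteSpace A]
    (adj : Fin N → Fin N → Prop) [DecidableRel adj]
    (hsymm : ∀ v w, adj v w → adj w v) (hirr : ∀ v, ¬ adj v v)
    (ce : Fin N → Fin N → CE) (hce : ∀ v w, ce v w = ce w v)
    (cV : Fin N → CV) (pl : CV → ℕ) (hpl : Function.Injective pl) (c0 : CE)
    (w : Fin N → Fin N → A) (hmw : IsMagicUnitary w)
    (hvcol : ∀ v x : Fin N, cV v ≠ cV x → w v x = 0)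
    (hcommG : ∀ (c : CE) (v x : Fin N),
      (∑ z, adjGMat A adj ce c v z * w z x) = ∑ z, w v z * adjGMat A adj ce c z x) :
    IsMagicUnitary (fun x y : PVert N cV pl =>
      if (x.2 : ℕ) = (y.2 : ℕ) then w x.1 y.1 else 0) ∧
    (∀ (c : CE) (x y : PVert N cV pl),
      (∑ z, adjPMat A adj ce cV pl c0 c x z *
          (if (z.2 : ℕ) = (y.2 : ℕ) then w z.1 y.1 else 0))
        = ∑ z, (if (x.2 : ℕ) = (z.2 : ℕ) then w x.1 z.1 else 0) *
            adjPMat A adj ce cV pl c0 c z y) := by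
  classical
  obtain ⟨hstar, hidem, hrow, hcol⟩ := hmw
  have hw : ∀ a b, pl (cV a) ≠ pl (cV b) → w a b = 0 :=
    fun a b h => hvcol a b fun e => h (congrArg pl e)
  refine ⟨⟨fun x y => ?_, fun x y => ?_, fun x => ?_, fun y => ?_⟩, fun c x y => ?_⟩
  · dsimp only
    split_ifs <;> simp [hstar]
  · dsimp only
    split_ifs <;> simp [hidem]
  · rw [← hrow x.1, ← sum_pVert_level cV pl x.2 (fun a => w x.1 a)
      fun a ha => hw _ _ (by have := x.2.isLt; omega)]
    simp only [eq_comm]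
  · rw [← hcol y.1]
    exact sum_pVert_level cV pl y.2 (fun a => w a y.1)
      fun a ha => hw _ _ (by have := y.2.isLt; omega)
  · let E : Prop := ((x.2 : ℕ) + 1 = (y.2 : ℕ) ∨ (y.2 : ℕ) + 1 = (x.2 : ℕ)) ∧ c = c0
    have hL := sum_pVert_level cV pl y.2
      (fun a => (if (x.2 : ℕ) = 0 ∧ (y.2 : ℕ) = 0 then adjGMat A adj ce c x.1 a * w a y.1 else 0) +
        (if x.1 = a then if E then w a y.1 else 0 else 0))
      fun a ha => by simp [hw a y.1 (by have := y.2.isLt; omega)]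
    have hR := sum_pVert_level cV pl x.2
      (fun a => (if (x.2 : ℕ) = 0 ∧ (y.2 : ℕ) = 0 then w x.1 a * adjGMat A adj ce c a y.1 else 0) +
        (if a = y.1 then if E then w x.1 a else 0 else 0))
      fun a ha => by simp [hw x.1 a (by have := x.2.isLt; omega)]
    trans ∑ a, ((if (x.2 : ℕ) = 0 ∧ (y.2 : ℕ) = 0 then adjGMat A adj ce c x.1 a * w a y.1 else 0) +
        (if x.1 = a then if E then w a y.1 else 0 else 0))
    · rw [← hL]
      refine Finset.sum_congr rfl fun z _ => ?_
      rw [adjPMat_eq_add]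
      by_cases h : (z.2 : ℕ) = y.2
      · simp only [h, if_true, add_mul, ite_mul, one_mul, zero_mul, E]
      · simp only [h, if_false, mul_zero]
    trans ∑ a, ((if (x.2 : ℕ) = 0 ∧ (y.2 : ℕ) = 0 then w x.1 a * adjGMat A adj ce c a y.1 else 0) +
        (if a = y.1 then if E then w x.1 a else 0 else 0))
    · rw [Finset.sum_add_distrib, Finset.sum_add_distrib, Finset.sum_ite_eq, Finset.sum_ite_eq',
        if_pos (Finset.mem_univ _), if_pos (Finset.mem_univ _)]
      congr 1
      split_ifs
      · exact hcommG c x.1 y.1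
      · rfl
    · rw [← hR]
      refine Finset.sum_congr rfl fun z _ => ?_
      rw [adjPMat_eq_add]
      by_cases h : (z.2 : ℕ) = x.2
      · simp only [h, if_true, mul_add, mul_ite, mul_one, mul_zero, E]
      · simp only [h, Ne.symm h, if_false, zero_mul]
end

section
/- Let A be a unital C*-algebra and let w = (w_{ij})_{1≤i,j≤n} be a magic unitary over A. Let i,j,k,l ∈ [n] with i ≠ k and j ≠ l. Then w_{ij}w_{kl} + w_{il}w_{kj} is a projection if and only if w_{ij}w_{kl} = w_{kl}w_{ij} and w_{il}w_{kj} = w_{kj}w_{il}. -/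
open scoped BigOperators

section CStarRing

variable {A : Type*} [NormedRing A] [StarRing A] [CStarRing A]

/-- A self-adjoint element with bounded powers is a contraction. -/
theorem IsSelfAdjoint.norm_le_one_of_norm_pow_le {a : A} (ha : IsSelfAdjoint a) {C : ℝ}
    (hC : ∀ n ≠ 0, ‖a ^ n‖ ≤ C) : ‖a‖ ≤ 1 := by
  by_contra! h
  obtain ⟨n, hn⟩ := pow_unbounded_of_one_lt C h
  have h₁ : ‖a‖ ^ n ≤ ‖a‖ ^ 2 ^ n := pow_le_pow_right₀ h.le Nat.lt_two_pow_self.le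
  have h₂ := hC (2 ^ n) (by positivity)
  rw [ha.norm_pow_two_pow] at h₂
  linarith

theorem IsStarProjection.norm_one_sub_mul_mul_le_one {p q : A} (hp : IsStarProjection p)
    (hq : IsStarProjection q) : ‖1 - p * q * p‖ ≤ 1 := by
  have hpp := hp.isIdempotentElem.eq
  have hps := hp.isSelfAdjoint.star_eq
  have hqs := hq.isSelfAdjoint.star_eq
  set m := star ((1 - q) * p) * ((1 - q) * p) with hm
  have hm_eq : m = p - p * q * p := by
    simp only [hm, star_mul, star_sub, star_one, hps, hqs]
    have : (1 - q) * (1 - q) = 1 - q := hq.one_sub.isIdempotentElem.eq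
    rw [mul_assoc, ← mul_assoc (1 - q), this]
    simp only [sub_mul, mul_sub, one_mul, mul_assoc, hpp]
  have hpm : p * m = m := by simp only [hm_eq, mul_sub, ← mul_assoc, hpp]
  have hmp : m * p = m := by simp only [hm_eq, sub_mul, mul_assoc, hpp]
  have hm_norm : ‖m‖ ≤ 1 := by
    rw [hm, CStarRing.norm_star_mul_self]
    have h : ‖(1 - q) * p‖ ≤ 1 := (norm_mul_le _ _).trans
      (mul_le_one₀ (IsStarProjection.norm_le _ hq.one_sub)
        (norm_nonneg _) (IsStarProjection.norm_le _ hp))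
    exact mul_le_one₀ h (norm_nonneg _) h
  have hpow (n : ℕ) : (1 - p * q * p) ^ (n + 1) = (1 - p) + m ^ (n + 1) := by
    have hy : 1 - p * q * p = (1 - p) + m := by rw [hm_eq]; abel
    induction n with
    | zero => simpa using hy
    | succ n ih =>
      rw [pow_succ, ih, hy, pow_succ m (n + 1)]
      have h₁ : (1 - p) * (1 - p) = 1 - p := hp.one_sub.isIdempotentElem.eq
      have h₂ : (1 - p) * m = 0 := by rw [sub_mul, one_mul, hpm, sub_self]
      have h₃ : m ^ (n + 1) * (1 - p) = 0 := by
        rw [pow_succ, mul_assoc, mul_sub, mul_one, hmp, sub_self, mul_zero]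
      rw [add_mul, mul_add, mul_add, h₁, h₂, h₃, add_zero, zero_add]
  have hsa : IsSelfAdjoint (1 - p * q * p) := by
    simp [isSelfAdjoint_iff, star_mul, hps, hqs, mul_assoc]
  refine hsa.norm_le_one_of_norm_pow_le (C := 2) fun n hn => ?_
  obtain ⟨n, rfl⟩ := Nat.exists_eq_succ_of_ne_zero hn
  rw [Nat.succ_eq_add_one, hpow]
  calc ‖(1 - p) + m ^ (n + 1)‖ ≤ ‖1 - p‖ + ‖m ^ (n + 1)‖ := norm_add_le _ _
    _ ≤ 1 + 1 := add_le_add (IsStarProjection.norm_le _ hp.one_sub)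
        ((norm_pow_le' m n.succ_pos).trans (pow_le_one₀ (norm_nonneg _) hm_norm))
    _ = 2 := by norm_num

variable [NormedAlgebra ℂ A] [CompleteSpace A]

/-- Unlike `IsSelfAdjoint.spectralRadius_eq_nnnorm`, this does not assume `StarModule ℂ A`. -/
theorem IsSelfAdjoint.eq_zero_of_spectrum_subset {a : A} (ha : IsSelfAdjoint a)
    (h : spectrum ℂ a ⊆ {0}) : a = 0 := by
  have hr : spectralRadius ℂ a = 0 := by
    simp only [spectralRadius, ENNReal.iSup_eq_zero]
    intro z hz
    simpa using h hz
  have hlim := (spectrum.pow_nnnorm_pow_one_div_tendsto_nhds_spectralRadius a).comp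
    (tendsto_pow_atTop_atTop_of_one_lt one_lt_two)
  have hconst : Filter.Tendsto (fun _ : ℕ => (‖a‖₊ : ENNReal)) Filter.atTop
      (nhds (spectralRadius ℂ a)) := by
    refine hlim.congr fun n => ?_
    rw [Function.comp_apply, ha.nnnorm_pow_two_pow, ENNReal.coe_pow, ← ENNReal.rpow_natCast,
      ← ENNReal.rpow_mul]
    simp
  have h₀ := tendsto_nhds_unique tendsto_const_nhds hconst
  rw [hr] at h₀
  simpa using h₀

theorem IsSelfAdjoint.eq_zero_of_norm_one_sub_le_of_norm_natCast_add_le {a : A}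
    (ha : IsSelfAdjoint a) (h : ‖1 - a‖ ≤ 1) (N : ℕ) (hN : ‖(N : A) + a‖ ≤ N) : a = 0 := by
  nontriviality A
  refine ha.eq_zero_of_spectrum_subset fun z hz => ?_
  have h₁ : ‖1 - z‖ ≤ 1 := by
    refine (spectrum.norm_le_norm_of_mem (a := 1 - a) ?_).trans h
    have := (spectrum.singleton_sub_eq a (1 : ℂ)).subset (Set.sub_mem_sub rfl hz)
    simpa using this
  have h₂ : ‖(N : ℂ) + z‖ ≤ N := by
    refine (spectrum.norm_le_norm_of_mem (a := (N : A) + a) ?_).trans hN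
    have := (spectrum.add_mem_add_iff (s := (N : ℂ))).mpr hz
    simpa [add_comm] using this
  have h₃ : (1 - z.re) ^ 2 + z.im ^ 2 ≤ 1 := by
    have := pow_le_one₀ (n := 2) (norm_nonneg _) h₁
    rw [← Complex.normSq_eq_norm_sq, Complex.normSq_apply] at this
    simp at this
    nlinarith
  have h₄ : (N + z.re) ^ 2 + z.im ^ 2 ≤ (N : ℝ) ^ 2 := by
    have := pow_le_pow_left₀ (norm_nonneg _) h₂ 2
    rw [← Complex.normSq_eq_norm_sq, Complex.normSq_apply] at this
    simp at this
    nlinarith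
  have h₅ : 0 ≤ z.re := by nlinarith [sq_nonneg z.re, sq_nonneg z.im]
  have h₆ : 0 ≤ (N : ℝ) * z.re := by positivity
  have hre : z.re = 0 := by nlinarith [sq_nonneg z.re, sq_nonneg z.im]
  have him : z.im = 0 := by nlinarith [sq_nonneg z.re, sq_nonneg z.im]
  exact Complex.ext hre him

/-- Projections summing to `1` are pairwise orthogonal. -/
theorem IsStarProjection.mul_eq_zero_of_sum_eq_one {ι : Type*} [Fintype ι] {p : ι → A}
    (hp : ∀ i, IsStarProjection (p i)) (hsum : ∑ i, p i = 1) {i j : ι} (hij : i ≠ j) :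
    p i * p j = 0 := by
  classical
  have hs (k : ι) : star (p k) = p k := (hp k).isSelfAdjoint.star_eq
  have hii : p i * p i = p i := (hp i).isIdempotentElem.eq
  set a : ι → A := fun k => p i * p k * p i with ha
  set S : Finset ι := (Finset.univ.erase i).erase j with hS
  have hsum₀ : a j + ∑ k ∈ S, a k = 0 := by
    have h₁ : ∑ k, a k = p i := by
      simp only [ha, ← Finset.sum_mul, ← Finset.mul_sum, hsum, mul_one, hii]
    rw [← Finset.add_sum_erase _ _ (Finset.mem_univ i),
      ← Finset.add_sum_erase _ _ (Finset.mem_erase.mpr ⟨hij.symm, Finset.mem_univ j⟩)] at h₁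
    have h₂ : a i = p i := by simp only [ha, hii]
    rw [h₂] at h₁
    simpa using h₁
  have hN : ‖(S.card : A) + a j‖ ≤ S.card := by
    have h : (S.card : A) + a j = ∑ k ∈ S, (1 - a k) := by
      rw [Finset.sum_sub_distrib, eq_neg_of_add_eq_zero_left hsum₀]
      simp [sub_eq_add_neg]
    rw [h]
    refine (norm_sum_le_of_le S fun k _ =>
      (hp i).norm_one_sub_mul_mul_le_one (hp k)).trans ?_
    simp
  have hsa : IsSelfAdjoint (a j) := by
    simp [isSelfAdjoint_iff, ha, star_mul, hs, mul_assoc]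
  have h₀ : a j = 0 := hsa.eq_zero_of_norm_one_sub_le_of_norm_natCast_add_le
    ((hp i).norm_one_sub_mul_mul_le_one (hp j)) _ hN
  rw [← CStarRing.mul_star_self_eq_zero_iff, star_mul, hs, hs, mul_assoc, ← mul_assoc (p j),
    (hp j).isIdempotentElem.eq, ← mul_assoc]
  exact h₀

end CStarRing

/-- The purely algebraic core: `a, c` and `b, d` are the rows, and `a, d` and `c, b` the columns,
of pairwise orthogonal projections. -/
theorem isStarProjection_mul_add_mul_iff {A : Type*} [Ring A] [StarRing A] {a b c d : A}
    (ha : IsStarProjection a) (hb : IsStarProjection b) (hc : IsStarProjection c)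
    (hd : IsStarProjection d) (hac : a * c = 0) (hca : c * a = 0) (had : a * d = 0)
    (hbc : b * c = 0) (hcb : c * b = 0) :
    IsStarProjection (a * b + c * d) ↔ a * b = b * a ∧ c * d = d * c := by
  have has := ha.isSelfAdjoint.star_eq
  have hbs := hb.isSelfAdjoint.star_eq
  have hcs := hc.isSelfAdjoint.star_eq
  have hds := hd.isSelfAdjoint.star_eq
  refine ⟨fun h => ?_, fun ⟨hab, hcd⟩ => ?_⟩
  · have hx : b * a + d * c = a * b + c * d := by
      simpa [star_mul, has, hbs, hcs, hds] using h.isSelfAdjoint.star_eq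
    have haba : a * b * a = a * b := by
      have := congrArg (a * ·) hx
      simpa [mul_add, ← mul_assoc, ha.isIdempotentElem.eq, had, hac] using this
    have hcdc : c * d * c = c * d := by
      have := congrArg (c * ·) hx
      simpa [mul_add, ← mul_assoc, hc.isIdempotentElem.eq, hcb, hca] using this
    constructor
    · have := congrArg star haba
      simp only [star_mul, has, hbs, ← mul_assoc] at this
      exact haba.symm.trans this
    · have := congrArg star hcdc
      simp only [star_mul, hcs, hds, ← mul_assoc] at this
      exact hcdc.symm.trans this
  · refine (ha.mul hb hab).add (hc.mul hd hcd) ?_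
    rw [mul_assoc, ← mul_assoc b, hbc, zero_mul, mul_zero]

/-- Lemma 4.7: for a magic unitary `w` and indices `i ≠ k`, `j ≠ l`, the element
`w_{ij}w_{kl} + w_{il}w_{kj}` is a projection if and only if `w_{ij}` commutes with
`w_{kl}` and `w_{il}` commutes with `w_{kj}`. -/
theorem sumIsProjectionIffCommute
    {n : ℕ} {A : Type*}
    [NormedRing A] [StarRing A] [CStarRing A] [NormedAlgebra ℂ A] [CompleteSpace A]
    (w : Fin n → Fin n → A) (hmu : IsMagicUnitary w)
    (i j k l : Fin n) (hik : i ≠ k) (hjl : j ≠ l) :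
    (star (w i j * w k l + w i l * w k j) = w i j * w k l + w i l * w k j ∧
      (w i j * w k l + w i l * w k j) * (w i j * w k l + w i l * w k j)
        = w i j * w k l + w i l * w k j) ↔
    (w i j * w k l = w k l * w i j ∧ w i l * w k j = w k j * w i l) := by
  obtain ⟨hstar, hidem, hrow, hcol⟩ := hmu
  have hw (x y : Fin n) : IsStarProjection (w x y) := ⟨hidem x y, hstar x y⟩
  have row (x : Fin n) {y z : Fin n} (h : y ≠ z) : w x y * w x z = 0 :=
    IsStarProjection.mul_eq_zero_of_sum_eq_one (hw x) (hrow x) h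
  have col (y : Fin n) {x z : Fin n} (h : x ≠ z) : w x y * w z y = 0 :=
    IsStarProjection.mul_eq_zero_of_sum_eq_one (fun x => hw x y) (hcol y) h
  rw [← isStarProjection_mul_add_mul_iff (hw i j) (hw k l) (hw i l) (hw k j) (row i hjl)
    (row i hjl.symm) (col j hik) (col l hik.symm) (col l hik)]
  exact ⟨fun h => ⟨h.2, h.1⟩, fun h => ⟨h.isSelfAdjoint, h.isIdempotentElem⟩⟩
end

section
/- Let G be a finite vertex- and edge-colored graph with deg(v) ≥ 3 for all v ∈ V(G), let G′ be the edge-colored graph obtained from G by the path-attachment construction (with path-edge color c_0), and let G″ be the uncolored graph obtained from G′ by the edge-subdivision construction. Let u be a magic unitary over a unital C*-algebra indexed by V(G″) with A_{G″} u = u A_{G″}. Then: (i) u_{xy} = 0 whenever x and y lie in different parts of the partition of V(G″) into V(G′), E_0′, E_1′, …, E_m′; (ii) for all edges e,f of G′ with colors ≠ c_0 and all applicable i, u_{e_i f_i} = u_{e_0 f_0}; (iii) u_{e_i f_i} = 0 whenever e and f have different colors in G′; and (iv) if e = (a,b) and f = (p,q) have the same color in G′, then u_{e_i f_i} = u_{ap}u_{bq}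 + u_{aq}u_{bp}. -/
open scoped BigOperators

/-- The subdivision vertices of `G''`: for each edge `e = (a,b)` of `G'` (i.e. of `G`),
`a < b`, of color `ce a b ≠ c0`, the vertices `e_0, e_1, …, e_{ml (ce a b)}` of the
subdivision vertex `e_0` together with its attached path. -/
abbrev SVert (N : ℕ) {CE : Type*} [DecidableEq CE]
    (adj : Fin N → Fin N → Prop) [DecidableRel adj]
    (ce : Fin N → Fin N → CE) (c0 : CE) (ml : CE → ℕ) : Type :=
  Σ e : {q : Fin N × Fin N // q.1 < q.2 ∧ adj q.1 q.2 ∧ ce q.1 q.2 ≠ c0},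
    Fin (ml (ce e.1.1 e.1.2) + 1)

/-- The vertex set of `G''`: the vertices of `G'` together with the subdivision
vertices and their attached paths. -/
abbrev DVert (N : ℕ) {CV CE : Type*} [DecidableEq CE] (cV : Fin N → CV)
    (pl : CV → ℕ) (adj : Fin N → Fin N → Prop) [DecidableRel adj]
    (ce : Fin N → Fin N → CE) (c0 : CE) (ml : CE → ℕ) : Type :=
  PVert N cV pl ⊕ SVert N adj ce c0 ml

/-- The adjacency relation of the uncolored graph `G''`: the `c0`-colored edges of `G'`
and its path edges survive; each edge `e = (a,b)` of `G'` of color `≠ c0` is replaced by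
the edges `(a, e_0)`, `(e_0, b)`; and the path `e_0 — e_1 — ⋯` is attached at `e_0`. -/
def adjD {N : ℕ} {CV CE : Type*} [DecidableEq CE] (cV : Fin N → CV) (pl : CV → ℕ)
    (adj : Fin N → Fin N → Prop) [DecidableRel adj]
    (ce : Fin N → Fin N → CE) (c0 : CE) (ml : CE → ℕ) :
    DVert N cV pl adj ce c0 ml → DVert N cV pl adj ce c0 ml → Prop
  | Sum.inl x, Sum.inl y =>
      ((x.2 : ℕ) = 0 ∧ (y.2 : ℕ) = 0 ∧ adj x.1 y.1 ∧ ce x.1 y.1 = c0) ∨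
        (x.1 = y.1 ∧ ((x.2 : ℕ) + 1 = (y.2 : ℕ) ∨ (y.2 : ℕ) + 1 = (x.2 : ℕ)))
  | Sum.inl x, Sum.inr e =>
      (x.2 : ℕ) = 0 ∧ (e.2 : ℕ) = 0 ∧ (x.1 = e.1.1.1 ∨ x.1 = e.1.1.2)
  | Sum.inr e, Sum.inl x =>
      (x.2 : ℕ) = 0 ∧ (e.2 : ℕ) = 0 ∧ (x.1 = e.1.1.1 ∨ x.1 = e.1.1.2)
  | Sum.inr e, Sum.inr f =>
      e.1 = f.1 ∧ ((e.2 : ℕ) + 1 = (f.2 : ℕ) ∨ (f.2 : ℕ) + 1 = (e.2 : ℕ))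

open Classical in
/-- The 0/1 adjacency matrix (entries in `A`) of `G''`. -/
noncomputable def adjDMat (A : Type*) [Zero A] [One A] {N : ℕ} {CV CE : Type*}
    [DecidableEq CE] (cV : Fin N → CV) (pl : CV → ℕ)
    (adj : Fin N → Fin N → Prop) [DecidableRel adj]
    (ce : Fin N → Fin N → CE) (c0 : CE) (ml : CE → ℕ)
    (x y : DVert N cV pl adj ce c0 ml) : A :=
  if adjD cV pl adj ce c0 ml x y then 1 else 0


section ProjectionPartition

variable {A : Type*} [NormedRing A] [NormedAlgebra ℂ A]

/-- Nonzero spectral values of an element of the corner `p A p` shift as in the corner. -/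
lemma sub_mem_spectrum_smul_sub {p h : A} (hp : p * p = p) (hph : p * h = h) (hhp : h * p = h)
    {c l : ℂ} (hl : l ≠ 0) (hmem : l ∈ spectrum ℂ h) : c - l ∈ spectrum ℂ (c • p - h) := by
  rw [spectrum.mem_iff] at hmem ⊢
  contrapose! hmem
  obtain ⟨y, hy⟩ := hmem
  have hy' : (y : A) = (c - l) • (1 : A) - (c • p - h) := by
    rw [hy, Algebra.algebraMap_eq_smul_one]
  have hpy : p * y = h - l • p := by
    rw [hy']; simp only [mul_sub, sub_smul, mul_smul_comm, mul_one, hp, hph]; abel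
  have hyp : y * p = h - l • p := by
    rw [hy']; simp only [sub_mul, sub_smul, smul_mul_assoc, one_mul, hp, hhp]; abel
  have hcomm : Commute p (↑y⁻¹ : A) := by
    apply Commute.units_inv_right
    rw [commute_iff_eq, hpy, hyp]
  have hr : (h - l • p) * (↑y⁻¹ : A) = p := by rw [← hpy, mul_assoc, y.mul_inv, mul_one]
  have hr' : (↑y⁻¹ : A) * (h - l • p) = p := by rw [← hyp, ← mul_assoc, y.inv_mul, one_mul]
  rw [Algebra.algebraMap_eq_smul_one]
  have key : l • (1 : A) - h = l • (1 - p) - (h - l • p) := by rw [smul_sub]; abel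
  have h1 : (1 - p) * (h - l • p) = 0 := by
    simp [sub_mul, mul_sub, hp, hph]
  have h2 : (h - l • p) * (1 - p) = 0 := by
    simp [sub_mul, mul_sub, hp, hhp]
  have h3 : (1 - p) * (1 - p) = 1 - p := by simp [sub_mul, mul_sub, hp]
  have h4 : (1 - p) * p = 0 := by simp [sub_mul, hp]
  have h5 : p * (1 - p) = 0 := by simp [mul_sub, hp]
  refine ⟨⟨l • (1 : A) - h, l⁻¹ • (1 - p) - p * ↑y⁻¹, ?_, ?_⟩, rfl⟩
  · rw [key, sub_mul, mul_sub, mul_sub, smul_mul_smul_comm, mul_inv_cancel₀ hl, h3,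
      smul_mul_assoc, ← mul_assoc, h4, mul_smul_comm, h2, hcomm.eq, ← mul_assoc, hr, hp]
    simp
  · rw [key, mul_sub, sub_mul, sub_mul, smul_mul_smul_comm, inv_mul_cancel₀ hl, h3,
      smul_mul_assoc (l⁻¹) _ (h - l • p), h1, mul_assoc p _ (h - l • p), hr', hp, mul_smul_comm l, hcomm.eq,
      mul_assoc, h5]
    simp

variable [CompleteSpace A] [StarRing A] [CStarRing A]

lemma eq_zero_of_norm_smul_add_sub_le {p h : A} {M : ℝ} (hp : p * p = p) (hph : p * h = h)
    (hhp : h * p = h) (hh : star h = h) (hsub : ‖(M : ℂ) • p - h‖ ≤ M)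
    (hadd : ‖(M : ℂ) • p + h‖ ≤ M) : h = 0 := by
  nontriviality A
  have hone : ‖(1 : A)‖ = 1 := CStarRing.norm_one
  have hspec : ∀ l ∈ spectrum ℂ h, l = 0 := by
    intro l hl
    by_contra hl0
    have h1 := spectrum.norm_le_norm_mul_of_mem (sub_mem_spectrum_smul_sub hp hph hhp
      (c := (M : ℂ)) hl0 hl)
    have h2 := spectrum.norm_le_norm_mul_of_mem (sub_mem_spectrum_smul_sub (h := -h) hp
      (by simp [hph]) (by simp [hhp]) (c := (M : ℂ)) (l := -l) (neg_ne_zero.2 hl0)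
      (by rw [← spectrum.neg_eq]; simpa using hl))
    rw [hone, mul_one] at h1 h2
    rw [sub_neg_eq_add, sub_neg_eq_add] at h2
    have h3 := parallelogram_law_with_norm ℝ (M : ℂ) l
    have h4 : ‖(M : ℂ)‖ * ‖(M : ℂ)‖ = M * M := by
      rw [Complex.norm_real]; exact abs_mul_abs_self M
    have h5 : 0 < ‖l‖ := norm_pos_iff.2 hl0
    have h6 := mul_self_le_mul_self (norm_nonneg _) (h1.trans hsub)
    have h7 := mul_self_le_mul_self (norm_nonneg _) (h2.trans hadd)
    nlinarith
  have hr : spectralRadius ℂ h = 0 := by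
    simp only [spectralRadius, ENNReal.iSup_eq_zero]
    intro l hl
    simp [hspec l hl]
  have hlim := (spectrum.pow_nnnorm_pow_one_div_tendsto_nhds_spectralRadius h).comp
    (tendsto_pow_atTop_atTop_of_one_lt one_lt_two)
  have hconst : Filter.Tendsto (fun _ : ℕ => (‖h‖₊ : ENNReal)) Filter.atTop (nhds 0) := by
    rw [← hr]
    refine hlim.congr fun n => ?_
    have hpow : ‖h ^ 2 ^ n‖₊ = ‖h‖₊ ^ 2 ^ n := IsSelfAdjoint.nnnorm_pow_two_pow hh n
    simp only [Function.comp_apply, hpow]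
    rw [ENNReal.coe_pow, ← ENNReal.rpow_natCast, ← ENNReal.rpow_mul]
    simp
  simpa using tendsto_nhds_unique tendsto_const_nhds hconst

/-- Projections summing to `1` are mutually orthogonal. -/
lemma mul_eq_zero_of_projections_sum_eq_one {ι : Type*} [Fintype ι] {p : ι → A}
    (hs : ∀ i, star (p i) = p i) (hp : ∀ i, p i * p i = p i) (hsum : ∑ i, p i = 1)
    {i j : ι} (hij : i ≠ j) : p i * p j = 0 := by
  classical
  have hcompr : ∀ k, ‖p j - p j * p k * p j‖ ≤ 1 := by
    intro k
    have h1 : star ((1 - p k) * p j) * ((1 - p k) * p j) = p j - p j * p k * p j := by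
      have : (1 - p k) * (1 - p k) = 1 - p k := by simp [sub_mul, mul_sub, hp]
      rw [star_mul, star_sub, star_one, hs, hs, mul_assoc, ← mul_assoc (1 - p k), this]
      simp [sub_mul, mul_sub, hp, mul_assoc]
    rw [← h1, CStarRing.norm_star_mul_self]
    have h2 : ‖(1 - p k) * p j‖ ≤ 1 := by
      refine (norm_mul_le _ _).trans (mul_le_one₀ ?_ (norm_nonneg _) ?_)
      · exact IsStarProjection.norm_le _ (IsStarProjection.one_sub ⟨hp k, hs k⟩)
      · exact IsStarProjection.norm_le _ ⟨hp j, hs j⟩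
    exact mul_le_one₀ h2 (norm_nonneg _) h2
  set T := (Finset.univ.erase j).erase i with hT
  have hiT : i ∈ Finset.univ.erase j := by simp [hij]
  have hzero : p j * p i * p j + ∑ k ∈ T, p j * p k * p j = 0 := by
    rw [hT, Finset.add_sum_erase _ (fun k => p j * p k * p j) hiT]
    have h1 : ∑ k, p j * p k * p j = p j := by
      rw [← Finset.sum_mul, ← Finset.mul_sum, hsum, mul_one, hp]
    rw [← Finset.add_sum_erase _ _ (Finset.mem_univ j), hp, hp] at h1
    simpa using h1
  have hpj : ‖p j‖ ≤ 1 := IsStarProjection.norm_le _ ⟨hp j, hs j⟩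
  have hadd : ‖((T.card : ℝ) : ℂ) • p j + p j * p i * p j‖ ≤ T.card := by
    have : ((T.card : ℝ) : ℂ) • p j + p j * p i * p j = ∑ k ∈ T, (p j - p j * p k * p j) := by
      rw [Finset.sum_sub_distrib, eq_neg_of_add_eq_zero_left hzero, Finset.sum_const,
        Complex.ofReal_natCast, Nat.cast_smul_eq_nsmul, sub_eq_add_neg]
    rw [this]
    exact (norm_sum_le_of_le T fun k _ => hcompr k).trans (by simp)
  have hM : ∀ x : A, (((T.card : ℝ) + 1 : ℝ) : ℂ) • p j + x
      = p j + (((T.card : ℝ) : ℂ) • p j + x) := by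
    intro x
    rw [Complex.ofReal_add, add_smul, Complex.ofReal_one, one_smul]
    abel
  have hz : p j * p i * p j = 0 := by
    apply eq_zero_of_norm_smul_add_sub_le (p := p j) (M := (T.card : ℝ) + 1) (hp j)
    · rw [← mul_assoc, ← mul_assoc, hp]
    · rw [mul_assoc, hp]
    · simp [hs, mul_assoc]
    · rw [sub_eq_add_neg, hM, add_left_comm, ← sub_eq_add_neg]
      refine (norm_add_le _ _).trans (add_le_add ?_ (hcompr i))
      rw [norm_smul, Complex.norm_real, Real.norm_natCast]
      exact mul_le_of_le_one_right (Nat.cast_nonneg _) hpj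
    · rw [hM, add_comm]
      exact (norm_add_le _ _).trans (add_le_add hadd hpj)
  rw [← CStarRing.star_mul_self_eq_zero_iff, star_mul, hs, hs, mul_assoc, ← mul_assoc (p i),
    hp, ← mul_assoc, hz]

end ProjectionPartition

section ColorRefinement

variable {V A : Type*}

/-- `u` vanishes between the set cut out by `P` and its complement. -/
def RespectsPred [Zero A] (u : V → V → A) (P : V → Prop) : Prop :=
  ∀ x y, ¬(P x ↔ P y) → u x y = 0

lemma RespectsPred.not [Zero A] {u : V → V → A} {P : V → Prop} (h : RespectsPred u P) :
    RespectsPred u fun x => ¬P x :=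
  fun x y hxy => h x y fun hP => hxy (not_congr hP)

lemma RespectsPred.and [Zero A] {u : V → V → A} {P Q : V → Prop} (hP : RespectsPred u P)
    (hQ : RespectsPred u Q) : RespectsPred u fun x => P x ∧ Q x := fun x y hxy => by
  by_cases h : P x ↔ P y
  · exact hQ x y fun h' => hxy (and_congr h h')
  · exact hP x y h

lemma RespectsPred.or [Zero A] {u : V → V → A} {P Q : V → Prop} (hP : RespectsPred u P)
    (hQ : RespectsPred u Q) : RespectsPred u fun x => P x ∨ Q x := fun x y hxy => by
  by_cases h : P x ↔ P y
  · exact hQ x y fun h' => hxy (or_congr h h')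
  · exact hP x y h

/-- `x` has at least `k` neighbors (for the relation `B`) satisfying `P`. -/
def HasNeighbors (B : V → V → Prop) (k : ℕ) (P : V → Prop) (x : V) : Prop :=
  ∃ s : Finset V, k ≤ s.card ∧ ∀ z ∈ s, B x z ∧ P z

open Classical in
/-- A magic unitary commuting with the adjacency matrix of `B` respects one round of
color refinement. -/
lemma RespectsPred.hasNeighbors [Fintype V] [NormedRing A] [StarRing A] [CStarRing A]
    [NormedAlgebra ℂ A] [CompleteSpace A] {u : V → V → A} (hu : IsMagicUnitary u)
    {B : V → V → Prop}
    (hB : ∀ x y, (∑ z, (if B x z then (1 : A) else 0) * u z y)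
      = ∑ z, u x z * (if B z y then (1 : A) else 0))
    {P : V → Prop} (hP : RespectsPred u P) (k : ℕ) :
    RespectsPred u (HasNeighbors B k P) := by
  obtain ⟨hs, hi, hrow, -⟩ := hu
  let g : V → ℕ := fun x => (Finset.univ.filter fun z => B x z ∧ P z).card
  have hg : ∀ x, HasNeighbors B k P x ↔ k ≤ g x := by
    intro x
    constructor
    · rintro ⟨s, hk, hsP⟩
      exact hk.trans (Finset.card_le_card fun z hz => by simpa using hsP z hz)
    · intro h
      exact ⟨_, h, fun z hz => by simpa using hz⟩
  have hfix : ∀ x, ∑ y, u x y * (if P y then (1 : A) else 0) = if P x then 1 else 0 := by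
    intro x
    have : ∀ y, u x y * (if P y then (1 : A) else 0) = u x y * (if P x then (1 : A) else 0) := by
      intro y
      by_cases h : P x ↔ P y
      · simp only [h]
      · simp [hP x y h]
    simp_rw [this, ← Finset.sum_mul, hrow, one_mul]
  have hgsum : ∀ x, ∑ y, (if B x y then (1 : A) else 0) * (if P y then (1 : A) else 0) = g x := by
    intro x
    simp only [g, Finset.card_filter, Nat.cast_sum, ite_and, ite_mul, one_mul, zero_mul]
    refine Finset.sum_congr rfl fun y _ => ?_
    split_ifs <;> simp
  have hgfix : ∀ x, ∑ z, u x z * (g z : A) = g x := by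
    intro x
    calc ∑ z, u x z * (g z : A)
        = ∑ y, (∑ z, u x z * (if B z y then (1 : A) else 0)) * (if P y then (1 : A) else 0) := by
          simp_rw [← hgsum, Finset.mul_sum, Finset.sum_mul, mul_assoc]
          exact Finset.sum_comm
      _ = ∑ y, (∑ z, (if B x z then (1 : A) else 0) * u z y) * (if P y then (1 : A) else 0) := by
          simp_rw [hB]
      _ = ∑ z, (if B x z then (1 : A) else 0) * (∑ y, u z y * (if P y then (1 : A) else 0)) := by
          simp_rw [Finset.mul_sum, Finset.sum_mul, mul_assoc]
          exact Finset.sum_comm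
      _ = g x := by simp_rw [hfix, hgsum]
  intro x y hxy
  have hne : (g y : ℂ) - g x ≠ 0 := by
    rw [sub_ne_zero, Ne, Nat.cast_inj]
    intro h
    exact hxy (by rw [hg, hg, h])
  have h1 : u x y * (g y : A) = u x y * (g x : A) := by
    rw [← hgfix x, Finset.mul_sum, Finset.sum_eq_single y, ← mul_assoc, hi]
    · intro z _ hz
      rw [← mul_assoc, mul_eq_zero_of_projections_sum_eq_one (hs x) (hi x) (hrow x) hz.symm,
        zero_mul]
    · simp
  have h2 : ((g y : ℂ) - g x) • u x y = 0 := by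
    rw [sub_smul, Nat.cast_smul_eq_nsmul, Nat.cast_smul_eq_nsmul, nsmul_eq_mul', nsmul_eq_mul',
      h1, sub_self]
  exact (smul_eq_zero.1 h2).resolve_left hne

lemma RespectsPred.congr [Zero A] {u : V → V → A} {P Q : V → Prop} (hP : RespectsPred u P)
    (h : ∀ x, P x ↔ Q x) : RespectsPred u Q :=
  fun x y hxy => hP x y (by rwa [h, h])

end ColorRefinement

section SubdividedGraph

variable {N : ℕ} {CV CE : Type*} [DecidableEq CE] {cV : Fin N → CV} {pl : CV → ℕ}
  {adj : Fin N → Fin N → Prop} [DecidableRel adj] {ce : Fin N → Fin N → CE} {c0 : CE}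
  {ml : CE → ℕ}

/-- The distance from a vertex of `G''` to the starting point of its attached path. -/
def DVert.pos : DVert N cV pl adj ce c0 ml → ℕ
  | Sum.inl x => x.2
  | Sum.inr e => e.2

/-- The original vertex or the edge to which the path containing a vertex is attached. -/
def DVert.root : DVert N cV pl adj ce c0 ml →
    Fin N ⊕ {q : Fin N × Fin N // q.1 < q.2 ∧ adj q.1 q.2 ∧ ce q.1 q.2 ≠ c0}
  | Sum.inl x => Sum.inl x.1
  | Sum.inr e => Sum.inr e.1

lemma DVert.ext_root_pos {x y : DVert N cV pl adj ce c0 ml} (hr : DVert.root x = DVert.root y)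
    (hp : DVert.pos x = DVert.pos y) : x = y := by
  rcases x with ⟨v, i⟩ | ⟨e, i⟩ <;> rcases y with ⟨w, j⟩ | ⟨f, j⟩ <;>
    simp only [DVert.root, reduceCtorEq, Sum.inl.injEq, Sum.inr.injEq] at hr
  · subst hr
    simp only [DVert.pos] at hp
    rw [Fin.ext hp]
  · subst hr
    simp only [DVert.pos] at hp
    rw [Fin.ext hp]

lemma adjD_of_pos_ne_zero {x z : DVert N cV pl adj ce c0 ml} (hx : DVert.pos x ≠ 0)
    (h : adjD cV pl adj ce c0 ml x z) :
    DVert.root x = DVert.root z ∧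
      (DVert.pos x + 1 = DVert.pos z ∨ DVert.pos z + 1 = DVert.pos x) := by
  rcases x with ⟨v, i⟩ | ⟨e, i⟩ <;> rcases z with ⟨w, j⟩ | ⟨f, j⟩ <;>
    simp only [adjD, DVert.pos, DVert.root] at * <;> grind

lemma not_hasNeighbors_three_of_pos_ne_zero {x : DVert N cV pl adj ce c0 ml}
    (hx : DVert.pos x ≠ 0) :
    ¬HasNeighbors (adjD cV pl adj ce c0 ml) 3 (fun _ => True) x := by
  rintro ⟨s, hs, hsx⟩
  have : s.card ≤ ({DVert.pos x + 1, DVert.pos x - 1} : Finset ℕ).card := by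
    apply Finset.card_le_card_of_injOn DVert.pos
    · intro z hz
      have := (adjD_of_pos_ne_zero hx (hsx z hz).1).2
      simp only [Finset.coe_insert, Finset.coe_singleton, Set.mem_insert_iff,
        Set.mem_singleton_iff]
      omega
    · intro z hz z' hz' hzz
      exact DVert.ext_root_pos ((adjD_of_pos_ne_zero hx (hsx z hz).1).1.symm.trans
        (adjD_of_pos_ne_zero hx (hsx z' hz').1).1) hzz
  have := this.trans Finset.card_le_two
  omega

lemma not_hasNeighbors_two_of_pos_ne_zero {x : DVert N cV pl adj ce c0 ml}
    (hx : DVert.pos x ≠ 0) :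
    ¬HasNeighbors (adjD cV pl adj ce c0 ml) 2
      (HasNeighbors (adjD cV pl adj ce c0 ml) 3 (fun _ => True)) x := by
  rintro ⟨s, hs, hsx⟩
  have hz0 : ∀ z ∈ s, DVert.pos z = 0 := fun z hz => by
    by_contra h
    exact not_hasNeighbors_three_of_pos_ne_zero h (hsx z hz).2
  have : s.card ≤ 1 := Finset.card_le_one.2 fun z hz z' hz' =>
    DVert.ext_root_pos ((adjD_of_pos_ne_zero hx (hsx z hz).1).1.symm.trans
        (adjD_of_pos_ne_zero hx (hsx z' hz').1).1) ((hz0 z hz).trans (hz0 z' hz').symm)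
  omega

lemma exists_neighbor_of_adj (hsymm : ∀ v w, adj v w → adj w v) (hirr : ∀ v, ¬adj v v)
    (hce : ∀ v w, ce v w = ce w v) {v w : Fin N} (h : adj v w) :
    ∃ z : DVert N cV pl adj ce c0 ml, adjD cV pl adj ce c0 ml (Sum.inl ⟨v, 0⟩) z ∧
      DVert.pos z = 0 ∧ (DVert.root z = Sum.inl w ∨ ∃ e, DVert.root z = Sum.inr e ∧
        (e.1 = (v, w) ∨ e.1 = (w, v))) := by
  by_cases hc : ce v w = c0
  · exact ⟨Sum.inl ⟨w, 0⟩, by simp [adjD, h, hc], rfl, Or.inl rfl⟩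
  · rcases lt_trichotomy v w with hvw | rfl | hvw
    · exact ⟨Sum.inr ⟨⟨(v, w), hvw, h, hc⟩, 0⟩, by simp [adjD], rfl,
        Or.inr ⟨_, rfl, Or.inl rfl⟩⟩
    · exact absurd h (hirr v)
    · exact ⟨Sum.inr ⟨⟨(w, v), hvw, hsymm _ _ h, by rwa [hce]⟩, 0⟩, by simp [adjD], rfl,
        Or.inr ⟨_, rfl, Or.inr rfl⟩⟩

lemma exists_neighbors_pos_zero (hsymm : ∀ v w, adj v w → adj w v) (hirr : ∀ v, ¬adj v v)
    (hce : ∀ v w, ce v w = ce w v)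
    (hdeg : ∀ v : Fin N, 3 ≤ (Finset.univ.filter fun w => adj v w).card) (v : Fin N) :
    ∃ s : Finset (DVert N cV pl adj ce c0 ml), 3 ≤ s.card ∧
      ∀ z ∈ s, adjD cV pl adj ce c0 ml (Sum.inl ⟨v, 0⟩) z ∧ DVert.pos z = 0 := by
  classical
  have := fun w : {w // adj v w} =>
    exists_neighbor_of_adj (cV := cV) (pl := pl) (c0 := c0) (ml := ml) hsymm hirr hce w.2
  choose φ hφ hpos hroot using this
  have hinj : Function.Injective φ := by
    intro w w' hww
    have h1 := hroot w
    have h2 := hroot w'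
    rw [hww] at h1
    have hw := w.2
    have hv := hirr v
    ext1
    rcases h1 with h1 | ⟨e, h1, h1'⟩ <;> rcases h2 with h2 | ⟨e', h2, h2'⟩ <;>
      rw [h1] at h2 <;> simp only [reduceCtorEq, Sum.inl.injEq, Sum.inr.injEq] at h2
    · exact h2
    · subst h2
      rcases h1' with h1' | h1' <;> rw [h1'] at h2' <;> simp only [Prod.mk.injEq] at h2' <;>
        grind
  refine ⟨Finset.univ.image φ, ?_, ?_⟩
  · rw [Finset.card_image_of_injective _ hinj, Finset.card_univ, Fintype.card_subtype]
    exact hdeg v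
  · intro z hz
    obtain ⟨w, -, rfl⟩ := Finset.mem_image.1 hz
    exact ⟨hφ w, hpos w⟩

lemma DVert.eq_inl_zero {v : Fin N} {i : Fin (pl (cV v) + 1)}
    (hi : DVert.pos (Sum.inl ⟨v, i⟩ : DVert N cV pl adj ce c0 ml) = 0) :
    (Sum.inl ⟨v, i⟩ : DVert N cV pl adj ce c0 ml) = Sum.inl ⟨v, 0⟩ :=
  DVert.ext_root_pos rfl hi

lemma DVert.eq_inr_zero {e : {q : Fin N × Fin N // q.1 < q.2 ∧ adj q.1 q.2 ∧ ce q.1 q.2 ≠ c0}}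
    {i : Fin (ml (ce e.1.1 e.1.2) + 1)}
    (hi : DVert.pos (Sum.inr ⟨e, i⟩ : DVert N cV pl adj ce c0 ml) = 0) :
    (Sum.inr ⟨e, i⟩ : DVert N cV pl adj ce c0 ml) = Sum.inr ⟨e, 0⟩ :=
  DVert.ext_root_pos rfl hi

/-- The vertices of positive position are recognized by their numbers of neighbors. -/
lemma pos_ne_zero_iff (hsymm : ∀ v w, adj v w → adj w v) (hirr : ∀ v, ¬adj v v)
    (hce : ∀ v w, ce v w = ce w v)
    (hdeg : ∀ v : Fin N, 3 ≤ (Finset.univ.filter fun w => adj v w).card)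
    (x : DVert N cV pl adj ce c0 ml) :
    (¬HasNeighbors (adjD cV pl adj ce c0 ml) 3 (fun _ => True) x ∧
      ¬HasNeighbors (adjD cV pl adj ce c0 ml) 2
        (HasNeighbors (adjD cV pl adj ce c0 ml) 3 (fun _ => True)) x) ↔ DVert.pos x ≠ 0 := by
  classical
  have h3 : ∀ v : Fin N, HasNeighbors (adjD cV pl adj ce c0 ml) 3 (fun _ => True)
      (Sum.inl ⟨v, 0⟩) := fun v => by
    obtain ⟨s, hs, hsv⟩ := exists_neighbors_pos_zero hsymm hirr hce hdeg v
    exact ⟨s, hs, fun z hz => ⟨(hsv z hz).1, trivial⟩⟩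
  refine ⟨fun h hx => ?_, fun h => ⟨not_hasNeighbors_three_of_pos_ne_zero h,
    not_hasNeighbors_two_of_pos_ne_zero h⟩⟩
  rcases x with ⟨v, i⟩ | ⟨e, i⟩
  · rw [DVert.eq_inl_zero hx] at h
    exact h.1 (h3 v)
  · rw [DVert.eq_inr_zero hx] at h
    refine h.2 ⟨{Sum.inl ⟨e.1.1, 0⟩, Sum.inl ⟨e.1.2, 0⟩}, ?_, ?_⟩
    · rw [Finset.card_pair]
      intro h
      have := congrArg DVert.root h
      simp only [DVert.root, Sum.inl.injEq] at this
      exact e.2.1.ne this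
    · intro z hz
      simp only [Finset.mem_insert, Finset.mem_singleton] at hz
      rcases hz with rfl | rfl
      · exact ⟨by simp [adjD], h3 _⟩
      · exact ⟨by simp [adjD], h3 _⟩

lemma adjD_inr_zero {e : {q : Fin N × Fin N // q.1 < q.2 ∧ adj q.1 q.2 ∧ ce q.1 q.2 ≠ c0}}
    {z : DVert N cV pl adj ce c0 ml} (h : adjD cV pl adj ce c0 ml (Sum.inr ⟨e, 0⟩) z) :
    z = Sum.inl ⟨e.1.1, 0⟩ ∨ z = Sum.inl ⟨e.1.2, 0⟩ ∨
      (DVert.root z = Sum.inr e ∧ DVert.pos z = 1) := by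
  rcases z with ⟨w, j⟩ | ⟨f, j⟩
  · simp only [adjD] at h
    obtain ⟨hj, -, rfl | rfl⟩ := h
    · exact Or.inl (DVert.eq_inl_zero hj)
    · exact Or.inr (Or.inl (DVert.eq_inl_zero hj))
  · simp only [adjD, Fin.val_zero] at h
    exact Or.inr (Or.inr ⟨congrArg Sum.inr h.1.symm, by simp only [DVert.pos]; omega⟩)

/-- The subdivision vertices are recognized among the vertices of position zero. -/
lemma pos_eq_zero_and_isRight_iff (hsymm : ∀ v w, adj v w → adj w v) (hirr : ∀ v, ¬adj v v)
    (hce : ∀ v w, ce v w = ce w v)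
    (hdeg : ∀ v : Fin N, 3 ≤ (Finset.univ.filter fun w => adj v w).card)
    (x : DVert N cV pl adj ce c0 ml) :
    (¬DVert.pos x ≠ 0 ∧ ¬HasNeighbors (adjD cV pl adj ce c0 ml) 4 (fun _ => True) x ∧
      (¬HasNeighbors (adjD cV pl adj ce c0 ml) 3 (fun _ => True) x ∨
        HasNeighbors (adjD cV pl adj ce c0 ml) 1 (fun z => DVert.pos z ≠ 0) x)) ↔
      x.isRight ∧ DVert.pos x ≤ 0 := by
  classical
  rw [Nat.le_zero, not_not, and_comm (a := (x.isRight : Prop))]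
  refine and_congr_right fun hx => ?_
  rcases x with ⟨v, i⟩ | ⟨e, i⟩
  · rw [DVert.eq_inl_zero hx]
    obtain ⟨s, hs, hsv⟩ := exists_neighbors_pos_zero (cV := cV) (pl := pl) (c0 := c0) (ml := ml)
      hsymm hirr hce hdeg v
    simp only [Sum.isRight_inl, Bool.false_eq_true, iff_false, not_and, not_or, not_not]
    intro h4
    refine ⟨⟨s, hs, fun z hz => ⟨(hsv z hz).1, trivial⟩⟩, ?_⟩
    rintro ⟨t, ht, htv⟩
    obtain ⟨z, hz⟩ := Finset.card_pos.1 ht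
    obtain ⟨hadj, hzpos⟩ := htv z hz
    refine h4 ⟨insert z s, ?_, ?_⟩
    · rw [Finset.card_insert_of_notMem fun hzs => hzpos (hsv z hzs).2]
      omega
    · intro z' hz'
      rcases Finset.mem_insert.1 hz' with rfl | hz'
      · exact ⟨hadj, trivial⟩
      · exact ⟨(hsv z' hz').1, trivial⟩
  · rw [DVert.eq_inr_zero hx]
    simp only [Sum.isRight_inr, iff_true]
    by_cases hm : ml (ce e.1.1 e.1.2) = 0
    · have hsub : ∀ s : Finset (DVert N cV pl adj ce c0 ml),
          (∀ z ∈ s, adjD cV pl adj ce c0 ml (Sum.inr ⟨e, 0⟩) z ∧ True) → s.card ≤ 2 := by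
        intro s hs
        refine (Finset.card_le_card (t := {Sum.inl ⟨e.1.1, 0⟩, Sum.inl ⟨e.1.2, 0⟩}) ?_).trans
          Finset.card_le_two
        intro z hz
        rw [Finset.mem_insert, Finset.mem_singleton]
        rcases adjD_inr_zero (hs z hz).1 with h | h | ⟨h, h'⟩
        · exact Or.inl h
        · exact Or.inr h
        · rcases z with ⟨w, j⟩ | ⟨f, j⟩
          · simp [DVert.root] at h
          · simp only [DVert.root, Sum.inr.injEq] at h
            subst h
            simp only [DVert.pos] at h'
            omega
      refine ⟨?_, Or.inl ?_⟩
      · rintro ⟨s, hs, h⟩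
        have := hsub s h
        omega
      · rintro ⟨s, hs, h⟩
        have := hsub s h
        omega
    · let e1 : DVert N cV pl adj ce c0 ml := Sum.inr ⟨e, ⟨1, by omega⟩⟩
      refine ⟨?_, Or.inr ⟨{e1}, by simp, ?_⟩⟩
      · rintro ⟨s, hs, h⟩
        have := (Finset.card_le_card (s := s)
          (t := {Sum.inl ⟨e.1.1, 0⟩, Sum.inl ⟨e.1.2, 0⟩, e1}) ?_).trans Finset.card_le_three
        · omega
        intro z hz
        simp only [Finset.mem_insert, Finset.mem_singleton]
        rcases adjD_inr_zero (h z hz).1 with h | h | ⟨h, h'⟩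
        · exact Or.inl h
        · exact Or.inr (Or.inl h)
        · exact Or.inr (Or.inr (DVert.ext_root_pos h h'))
      · intro z hz
        rw [Finset.mem_singleton.1 hz]
        simp [adjD, DVert.pos, e1]

/-- The vertices within distance `n + 1` of a subdivision vertex on its path are obtained
from those within distance `n` by adjoining neighbors of positive position. -/
lemma isRight_and_pos_le_succ_iff (n : ℕ) (x : DVert N cV pl adj ce c0 ml) :
    ((x.isRight ∧ DVert.pos x ≤ n) ∨ (DVert.pos x ≠ 0 ∧
      HasNeighbors (adjD cV pl adj ce c0 ml) 1 (fun z => z.isRight ∧ DVert.pos z ≤ n) x)) ↔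
      x.isRight ∧ DVert.pos x ≤ n + 1 := by
  constructor
  · rintro (⟨h, h'⟩ | ⟨h0, s, hs, h⟩)
    · exact ⟨h, h'.trans n.le_succ⟩
    · obtain ⟨z, hz⟩ := Finset.card_pos.1 hs
      obtain ⟨hadj, hzr, hzn⟩ := h z hz
      obtain ⟨hroot, hpos⟩ := adjD_of_pos_ne_zero h0 hadj
      refine ⟨?_, by omega⟩
      rcases x with x | x <;> rcases z with z | z <;> simp_all [DVert.root]
  · rintro ⟨h, h'⟩
    by_cases hn : DVert.pos x ≤ n
    · exact Or.inl ⟨h, hn⟩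
    · rcases x with x | ⟨e, i⟩
      · simp at h
      · simp only [DVert.pos] at hn h'
        refine Or.inr ⟨by simp only [DVert.pos]; omega,
          {Sum.inr ⟨e, ⟨n, by omega⟩⟩}, by simp, ?_⟩
        intro z hz
        rw [Finset.mem_singleton.1 hz]
        simp only [adjD, DVert.pos, Sum.isRight_inr, le_refl, and_true, true_and]
        omega

lemma respectsPred_isRight_and_pos_le {A : Type*} [NormedRing A] [StarRing A] [CStarRing A]
    [NormedAlgebra ℂ A] [CompleteSpace A]
    (hsymm : ∀ v w, adj v w → adj w v) (hirr : ∀ v, ¬adj v v) (hce : ∀ v w, ce v w = ce w v)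
    (hdeg : ∀ v : Fin N, 3 ≤ (Finset.univ.filter fun w => adj v w).card)
    {u : DVert N cV pl adj ce c0 ml → DVert N cV pl adj ce c0 ml → A}
    (hmu : IsMagicUnitary u)
    (hcomm : ∀ x y : DVert N cV pl adj ce c0 ml,
      (∑ z, adjDMat A cV pl adj ce c0 ml x z * u z y)
        = ∑ z, u x z * adjDMat A cV pl adj ce c0 ml z y) (n : ℕ) :
    RespectsPred u fun x => x.isRight ∧ DVert.pos x ≤ n := by
  have step {P} (hP : RespectsPred u P) (k : ℕ) := hP.hasNeighbors hmu hcomm k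
  have htrue : RespectsPred u fun _ => True := fun x y h => absurd Iff.rfl h
  have h3 := step htrue 3
  have hpos : RespectsPred u fun x => DVert.pos x ≠ 0 :=
    (h3.not.and (step h3 2).not).congr (pos_ne_zero_iff hsymm hirr hce hdeg)
  induction n with
  | zero =>
    exact (hpos.not.and ((step htrue 4).not.and (h3.not.or (step hpos 1)))).congr
      (pos_eq_zero_and_isRight_iff hsymm hirr hce hdeg)
  | succ n ih => exact (ih.or (hpos.and (step ih 1))).congr (isRight_and_pos_le_succ_iff n)

variable {A : Type*} [NormedRing A]

/-- The entry `u_{e_n f_n}`, or `0` if `e_n` or `f_n` does not exist. -/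
def pathEntry (u : DVert N cV pl adj ce c0 ml → DVert N cV pl adj ce c0 ml → A)
    (e f : {q : Fin N × Fin N // q.1 < q.2 ∧ adj q.1 q.2 ∧ ce q.1 q.2 ≠ c0}) (n : ℕ) : A :=
  if h : n < ml (ce e.1.1 e.1.2) + 1 ∧ n < ml (ce f.1.1 f.1.2) + 1 then
    u (Sum.inr ⟨e, ⟨n, h.1⟩⟩) (Sum.inr ⟨f, ⟨n, h.2⟩⟩) else 0

/-- Entries of `u` between different parts of `V(G') ∪ E_0' ∪ E_1' ∪ ⋯` vanish. -/
def IsBlockDiagonal (u : DVert N cV pl adj ce c0 ml → DVert N cV pl adj ce c0 ml → A) : Prop :=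
  ∀ x y, ¬(x.isRight = y.isRight ∧ (x.isRight → DVert.pos x = DVert.pos y)) → u x y = 0

variable {u : DVert N cV pl adj ce c0 ml → DVert N cV pl adj ce c0 ml → A}

lemma sum_adjDMat_mul_eq_pathEntry (hblock : IsBlockDiagonal u)
    (e f : {q : Fin N × Fin N // q.1 < q.2 ∧ adj q.1 q.2 ∧ ce q.1 q.2 ≠ c0})
    (i : Fin (ml (ce e.1.1 e.1.2) + 1))
    (j : Fin (ml (ce f.1.1 f.1.2) + 1)) (hij : (i : ℕ) + 1 = j ∨ (j : ℕ) + 1 = i) :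
    ∑ z, adjDMat A cV pl adj ce c0 ml (Sum.inr ⟨e, i⟩) z * u z (Sum.inr ⟨f, j⟩)
      = pathEntry u e f j := by
  have hz : ∀ z, adjD cV pl adj ce c0 ml (Sum.inr ⟨e, i⟩) z → u z (Sum.inr ⟨f, j⟩) ≠ 0 →
      DVert.root z = Sum.inr e ∧ DVert.pos z = j := by
    intro z hadj hne
    have := not_imp_comm.1 (hblock z (Sum.inr ⟨f, j⟩)) hne
    rcases z with z | ⟨g, k⟩
    · simp at this
    · simp only [adjD] at hadj
      simp only [Sum.isRight_inr, DVert.pos, true_and, forall_const] at this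
      exact ⟨congrArg Sum.inr hadj.1.symm, this⟩
  unfold pathEntry
  split_ifs with h
  · rw [Finset.sum_eq_single (Sum.inr ⟨e, ⟨j, h.1⟩⟩)]
    · rw [adjDMat, if_pos (by simpa [adjD] using hij), one_mul]
    · intro z _ hne
      by_contra h0
      obtain ⟨h1, h2⟩ := hz z (by
        by_contra h'
        exact h0 (by rw [adjDMat, if_neg h', zero_mul])) (right_ne_zero_of_mul h0)
      exact hne (DVert.ext_root_pos h1 h2)
    · simp
  · refine Finset.sum_eq_zero fun z _ => ?_
    by_contra h0
    obtain ⟨h1, h2⟩ := hz z (by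
      by_contra h'
      exact h0 (by rw [adjDMat, if_neg h', zero_mul])) (right_ne_zero_of_mul h0)
    rcases z with z | ⟨g, k⟩
    · simp [DVert.root] at h1
    · simp only [DVert.root, Sum.inr.injEq] at h1
      subst h1
      simp only [DVert.pos] at h2
      exact h ⟨h2 ▸ k.2, j.2⟩

lemma sum_mul_adjDMat_eq_pathEntry (hblock : IsBlockDiagonal u)
    (e f : {q : Fin N × Fin N // q.1 < q.2 ∧ adj q.1 q.2 ∧ ce q.1 q.2 ≠ c0})
    (i : Fin (ml (ce e.1.1 e.1.2) + 1))
    (j : Fin (ml (ce f.1.1 f.1.2) + 1)) (hij : (i : ℕ) + 1 = j ∨ (j : ℕ) + 1 = i) :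
    ∑ z, u (Sum.inr ⟨e, i⟩) z * adjDMat A cV pl adj ce c0 ml z (Sum.inr ⟨f, j⟩)
      = pathEntry u e f i := by
  have hz : ∀ z, adjD cV pl adj ce c0 ml z (Sum.inr ⟨f, j⟩) → u (Sum.inr ⟨e, i⟩) z ≠ 0 →
      DVert.root z = Sum.inr f ∧ DVert.pos z = i := by
    intro z hadj hne
    have := not_imp_comm.1 (hblock (Sum.inr ⟨e, i⟩) z) hne
    rcases z with z | ⟨g, k⟩
    · simp at this
    · simp only [adjD] at hadj
      simp only [Sum.isRight_inr, DVert.pos, true_and, forall_const] at this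
      exact ⟨congrArg Sum.inr hadj.1, this.symm⟩
  unfold pathEntry
  split_ifs with h
  · rw [Finset.sum_eq_single (Sum.inr ⟨f, ⟨i, h.2⟩⟩)]
    · rw [adjDMat, if_pos (by simpa [adjD] using hij), mul_one]
    · intro z _ hne
      by_contra h0
      obtain ⟨h1, h2⟩ := hz z (by
        by_contra h'
        exact h0 (by rw [adjDMat, if_neg h', mul_zero])) (left_ne_zero_of_mul h0)
      exact hne (DVert.ext_root_pos h1 h2)
    · simp
  · refine Finset.sum_eq_zero fun z _ => ?_
    by_contra h0
    obtain ⟨h1, h2⟩ := hz z (by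
      by_contra h'
      exact h0 (by rw [adjDMat, if_neg h', mul_zero])) (left_ne_zero_of_mul h0)
    rcases z with z | ⟨g, k⟩
    · simp [DVert.root] at h1
    · simp only [DVert.root, Sum.inr.injEq] at h1
      subst h1
      simp only [DVert.pos] at h2
      exact h ⟨i.2, h2 ▸ k.2⟩

lemma pathEntry_succ (hblock : IsBlockDiagonal u)
    (e f : {q : Fin N × Fin N // q.1 < q.2 ∧ adj q.1 q.2 ∧ ce q.1 q.2 ≠ c0})
    (hcomm : ∀ x y : DVert N cV pl adj ce c0 ml,
      (∑ z, adjDMat A cV pl adj ce c0 ml x z * u z y)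
        = ∑ z, u x z * adjDMat A cV pl adj ce c0 ml z y)
    (n : ℕ) : pathEntry u e f (n + 1) = pathEntry u e f n ∨
    (ml (ce e.1.1 e.1.2) = ml (ce f.1.1 f.1.2) ∧ ml (ce e.1.1 e.1.2) < n + 1) := by
  by_cases h1 : n < ml (ce e.1.1 e.1.2) + 1 ∧ n + 1 < ml (ce f.1.1 f.1.2) + 1
  · left
    have := hcomm (Sum.inr ⟨e, ⟨n, h1.1⟩⟩) (Sum.inr ⟨f, ⟨n + 1, h1.2⟩⟩)
    rwa [sum_adjDMat_mul_eq_pathEntry hblock _ _ _ _ (Or.inl rfl),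
      sum_mul_adjDMat_eq_pathEntry hblock _ _ _ _ (Or.inl rfl)] at this
  by_cases h2 : n + 1 < ml (ce e.1.1 e.1.2) + 1 ∧ n < ml (ce f.1.1 f.1.2) + 1
  · left
    have := hcomm (Sum.inr ⟨e, ⟨n + 1, h2.1⟩⟩) (Sum.inr ⟨f, ⟨n, h2.2⟩⟩)
    rw [sum_adjDMat_mul_eq_pathEntry hblock _ _ _ _ (Or.inr rfl),
      sum_mul_adjDMat_eq_pathEntry hblock _ _ _ _ (Or.inr rfl)] at this
    exact this.symm
  by_cases h3 : ml (ce e.1.1 e.1.2) = ml (ce f.1.1 f.1.2)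
  · right
    omega
  · left
    rw [pathEntry, pathEntry, dif_neg (by omega), dif_neg (by omega)]

lemma pathEntry_eq_pathEntry_zero (hblock : IsBlockDiagonal u)
    (e f : {q : Fin N × Fin N // q.1 < q.2 ∧ adj q.1 q.2 ∧ ce q.1 q.2 ≠ c0})
    (hcomm : ∀ x y : DVert N cV pl adj ce c0 ml,
      (∑ z, adjDMat A cV pl adj ce c0 ml x z * u z y)
        = ∑ z, u x z * adjDMat A cV pl adj ce c0 ml z y)
    {n : ℕ} (hn : n ≤ ml (ce e.1.1 e.1.2)) :
    pathEntry u e f n = pathEntry u e f 0 := by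
  induction n with
  | zero => rfl
  | succ n ih =>
    rcases pathEntry_succ hblock e f hcomm n with h | h
    · rw [h, ih (by omega)]
    · omega

lemma pathEntry_eq_zero (hblock : IsBlockDiagonal u)
    (e f : {q : Fin N × Fin N // q.1 < q.2 ∧ adj q.1 q.2 ∧ ce q.1 q.2 ≠ c0})
    (hcomm : ∀ x y : DVert N cV pl adj ce c0 ml,
      (∑ z, adjDMat A cV pl adj ce c0 ml x z * u z y)
        = ∑ z, u x z * adjDMat A cV pl adj ce c0 ml z y)
    (hne : ml (ce e.1.1 e.1.2) ≠ ml (ce f.1.1 f.1.2)) (n : ℕ) :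
    pathEntry u e f n = 0 := by
  have hconst : ∀ k, pathEntry u e f k = pathEntry u e f 0 := by
    intro k
    induction k with
    | zero => rfl
    | succ k ih =>
      rcases pathEntry_succ hblock e f hcomm k with h | h
      · rw [h, ih]
      · exact absurd h.1 hne
  rw [hconst n, ← hconst (ml (ce e.1.1 e.1.2) + 1), pathEntry, dif_neg (by omega)]

/-- The row of a subdivision vertex, summed over the subdivision vertices incident to `p`. -/
lemma sum_mul_adjDMat_inl (hblock : IsBlockDiagonal u)
    (e : {q : Fin N × Fin N // q.1 < q.2 ∧ adj q.1 q.2 ∧ ce q.1 q.2 ≠ c0})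
    (hcomm : ∀ x y : DVert N cV pl adj ce c0 ml,
      (∑ z, adjDMat A cV pl adj ce c0 ml x z * u z y)
        = ∑ z, u x z * adjDMat A cV pl adj ce c0 ml z y)
    (p : Fin N) :
    ∑ z, u (Sum.inr ⟨e, 0⟩) z * adjDMat A cV pl adj ce c0 ml z (Sum.inl ⟨p, 0⟩)
      = u (Sum.inl ⟨e.1.1, 0⟩) (Sum.inl ⟨p, 0⟩) + u (Sum.inl ⟨e.1.2, 0⟩) (Sum.inl ⟨p, 0⟩) := by
  have hne : (Sum.inl ⟨e.1.1, 0⟩ : DVert N cV pl adj ce c0 ml) ≠ Sum.inl ⟨e.1.2, 0⟩ := by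
    intro h
    have := congrArg DVert.root h
    simp only [DVert.root, Sum.inl.injEq] at this
    exact e.2.1.ne this
  rw [← hcomm, Fintype.sum_eq_add _ _ hne]
  · rw [adjDMat, if_pos (by simp [adjD]), adjDMat, if_pos (by simp [adjD]), one_mul, one_mul]
  · rintro z ⟨h1, h2⟩
    by_cases h : adjD cV pl adj ce c0 ml (Sum.inr ⟨e, 0⟩) z
    · rcases adjD_inr_zero h with h | h | h
      · exact absurd h h1
      · exact absurd h h2
      · rcases z with z | z
        · simp [DVert.root] at h
        · rw [hblock _ _ (by simp), mul_zero]
    · rw [adjDMat, if_neg h, zero_mul]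

lemma sum_mul_adjDMat_mul_sum_mul_adjDMat (hblock : IsBlockDiagonal u)
    (e f : {q : Fin N × Fin N // q.1 < q.2 ∧ adj q.1 q.2 ∧ ce q.1 q.2 ≠ c0})
    (hidem : ∀ x y, u x y * u x y = u x y)
    (horth : ∀ x y z, y ≠ z → u x y * u x z = 0) :
    (∑ z, u (Sum.inr ⟨e, 0⟩) z * adjDMat A cV pl adj ce c0 ml z (Sum.inl ⟨f.1.1, 0⟩)) *
      (∑ z, u (Sum.inr ⟨e, 0⟩) z * adjDMat A cV pl adj ce c0 ml z (Sum.inl ⟨f.1.2, 0⟩))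
      = u (Sum.inr ⟨e, 0⟩) (Sum.inr ⟨f, 0⟩) := by
  have hadj : ∀ z, u (Sum.inr ⟨e, 0⟩) z ≠ 0 →
      adjD cV pl adj ce c0 ml z (Sum.inl ⟨f.1.1, 0⟩) →
      adjD cV pl adj ce c0 ml z (Sum.inl ⟨f.1.2, 0⟩) → z = Sum.inr ⟨f, 0⟩ := by
    intro z h0 h1 h2
    rcases z with z | ⟨g, k⟩
    · exact absurd (hblock _ _ (by simp)) h0
    · simp only [adjD] at h1 h2
      have hgf : g = f := by
        have := f.2.1
        have := g.2.1
        ext1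
        ext1 <;> grind
      subst hgf
      exact DVert.eq_inr_zero h1.2.1
  have hterm : ∀ z z', u (Sum.inr ⟨e, 0⟩) z *
      adjDMat A cV pl adj ce c0 ml z (Sum.inl ⟨f.1.1, 0⟩) * (u (Sum.inr ⟨e, 0⟩) z' *
      adjDMat A cV pl adj ce c0 ml z' (Sum.inl ⟨f.1.2, 0⟩)) ≠ 0 →
      z = Sum.inr ⟨f, 0⟩ ∧ z' = Sum.inr ⟨f, 0⟩ := by
    intro z z' h
    have h1 : adjD cV pl adj ce c0 ml z (Sum.inl ⟨f.1.1, 0⟩) := by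
      by_contra h'
      exact h (by simp only [adjDMat, if_neg h', mul_zero, zero_mul])
    have h2 : adjD cV pl adj ce c0 ml z' (Sum.inl ⟨f.1.2, 0⟩) := by
      by_contra h'
      exact h (by simp only [adjDMat, if_neg h', mul_zero])
    simp only [adjDMat, if_pos h1, if_pos h2, mul_one] at h
    have hzz : z = z' := by
      by_contra h'
      exact h (horth _ _ _ h')
    subst hzz
    exact ⟨hadj z (left_ne_zero_of_mul h) h1 h2, hadj z (left_ne_zero_of_mul h) h1 h2⟩
  rw [Finset.sum_mul_sum, Finset.sum_eq_single (Sum.inr ⟨f, 0⟩),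
    Finset.sum_eq_single (Sum.inr ⟨f, 0⟩)]
  · rw [adjDMat, if_pos (by simp [adjD]), adjDMat, if_pos (by simp [adjD]), mul_one, hidem]
  · intro z _ hz
    by_contra h
    exact hz (hterm _ _ h).2
  · simp
  · intro z _ hz
    refine Finset.sum_eq_zero fun z' _ => ?_
    by_contra h
    exact hz (hterm _ _ h).1
  · simp

end SubdividedGraph

/-- For a `2 × 2` matrix of self-adjoint elements with orthogonal rows, whose second column is
orthogonal with idempotent first entry: if the product of the column sums is self-adjoint, it is
the permanent. -/
lemma add_mul_add_eq_of_orthogonal {R : Type*} [Ring R] [StarRing R] {ap aq bp bq w : R}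
    (hap : star ap = ap) (haq : star aq = aq) (hbp : star bp = bp) (hbq : star bq = bq)
    (hw : star w = w) (haa : ap * aq = 0) (hbb : bp * bq = 0)
    (hqq : aq * bq = 0) (hpi : aq * aq = aq)
    (h : (ap + bp) * (aq + bq) = w) : w = ap * bq + aq * bp := by
  have hw1 : w = ap * bq + bp * aq := by
    rw [← h, add_mul, mul_add, mul_add, haa, hbb, zero_add, add_zero]
  have hw2 : w = bq * ap + aq * bp := by
    rw [← hw, hw1, star_add, star_mul, star_mul, hap, haq, hbp, hbq]
  have h1 : w * aq = bp * aq := by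
    have hba : bq * aq = 0 := by simpa [haq, hbq] using congrArg star hqq
    rw [hw1, add_mul, mul_assoc, mul_assoc, hba, hpi, mul_zero, zero_add]
  have h2 : w * aq = aq * bp * aq := by
    rw [hw2, add_mul, mul_assoc bq, haa, mul_zero, zero_add]
  have h3 : bp * aq = aq * bp := by
    have h4 := h1.symm.trans h2
    have h5 := congrArg star h4
    simp only [star_mul, haq, hbp, ← mul_assoc] at h5
    exact h4.trans h5.symm
  rw [hw1, h3]


/-- Lemma 4.10: let `G` be a finite vertex- and edge-colored graph with all degrees at
least 3, `G'` the path-attached graph (path color `c0`, distinct path lengths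
`pl (cV v)`), and `G''` the uncolored graph obtained by subdividing the edges of color
`≠ c0` and attaching paths of distinct lengths `ml c`. If `u` is a magic unitary
commuting with the adjacency matrix of `G''`, then: (i) entries between different parts
of the partition `V(G') ∪ E_0' ∪ E_1' ∪ ⋯` vanish; (ii) `u_{e_i f_i} = u_{e_0 f_0}`;
(iii) `u_{e_i f_i} = 0` when `e` and `f` have different colors; (iv) if `e = (a,b)` and
`f = (p,q)` have the same color then `u_{e_i f_i} = u_{ap} u_{bq} + u_{aq} u_{bp}`. -/
theorem subdividedBlockStructure
    {N : ℕ} {CV CE A : Type*} [DecidableEq CE]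
    [NormedRing A] [StarRing A] [CStarRing A] [NormedAlgebra ℂ A] [CompleteSpace A]
    (adj : Fin N → Fin N → Prop) [DecidableRel adj]
    (hsymm : ∀ v w, adj v w → adj w v) (hirr : ∀ v, ¬ adj v v)
    (ce : Fin N → Fin N → CE) (hce : ∀ v w, ce v w = ce w v)
    (cV : Fin N → CV) (pl : CV → ℕ) (hpl : Function.Injective pl) (c0 : CE)
    (ml : CE → ℕ)
    (hml : ∀ c c' : CE, c ≠ c0 → c' ≠ c0 → ml c = ml c' → c = c')
    (hdeg : ∀ v : Fin N, 3 ≤ (Finset.univ.filter fun w => adj v w).card)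
    (u : DVert N cV pl adj ce c0 ml → DVert N cV pl adj ce c0 ml → A)
    (hmu : IsMagicUnitary u)
    (hcomm : ∀ x y : DVert N cV pl adj ce c0 ml,
      (∑ z, adjDMat A cV pl adj ce c0 ml x z * u z y)
        = ∑ z, u x z * adjDMat A cV pl adj ce c0 ml z y) :
    ((∀ (x : PVert N cV pl) (e : SVert N adj ce c0 ml),
        u (Sum.inl x) (Sum.inr e) = 0 ∧ u (Sum.inr e) (Sum.inl x) = 0) ∧
      (∀ e f : SVert N adj ce c0 ml, (e.2 : ℕ) ≠ (f.2 : ℕ) →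
        u (Sum.inr e) (Sum.inr f) = 0)) ∧
    (∀ (e f : {q : Fin N × Fin N // q.1 < q.2 ∧ adj q.1 q.2 ∧ ce q.1 q.2 ≠ c0})
        (i : Fin (ml (ce e.1.1 e.1.2) + 1)) (j : Fin (ml (ce f.1.1 f.1.2) + 1)),
      (i : ℕ) = (j : ℕ) →
        u (Sum.inr ⟨e, i⟩) (Sum.inr ⟨f, j⟩) = u (Sum.inr ⟨e, 0⟩) (Sum.inr ⟨f, 0⟩)) ∧
    (∀ (e f : {q : Fin N × Fin N // q.1 < q.2 ∧ adj q.1 q.2 ∧ ce q.1 q.2 ≠ c0})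
        (i : Fin (ml (ce e.1.1 e.1.2) + 1)) (j : Fin (ml (ce f.1.1 f.1.2) + 1)),
      (i : ℕ) = (j : ℕ) → ce e.1.1 e.1.2 ≠ ce f.1.1 f.1.2 →
        u (Sum.inr ⟨e, i⟩) (Sum.inr ⟨f, j⟩) = 0) ∧
    (∀ (e f : {q : Fin N × Fin N // q.1 < q.2 ∧ adj q.1 q.2 ∧ ce q.1 q.2 ≠ c0})
        (i : Fin (ml (ce e.1.1 e.1.2) + 1)) (j : Fin (ml (ce f.1.1 f.1.2) + 1)),
      (i : ℕ) = (j : ℕ) → ce e.1.1 e.1.2 = ce f.1.1 f.1.2 →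
        u (Sum.inr ⟨e, i⟩) (Sum.inr ⟨f, j⟩)
          = u (Sum.inl ⟨e.1.1, 0⟩) (Sum.inl ⟨f.1.1, 0⟩) *
              u (Sum.inl ⟨e.1.2, 0⟩) (Sum.inl ⟨f.1.2, 0⟩) +
            u (Sum.inl ⟨e.1.1, 0⟩) (Sum.inl ⟨f.1.2, 0⟩) *
              u (Sum.inl ⟨e.1.2, 0⟩) (Sum.inl ⟨f.1.1, 0⟩)) := by
  have hlevel := respectsPred_isRight_and_pos_le hsymm hirr hce hdeg hmu hcomm
  have hblock : IsBlockDiagonal u := by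
    intro x y hxy
    by_contra h0
    have h : ∀ n, (x.isRight ∧ DVert.pos x ≤ n) ↔ (y.isRight ∧ DVert.pos y ≤ n) := fun n => by
      by_contra h
      exact h0 (hlevel n x y h)
    have hx := h (DVert.pos x)
    have hy := h (DVert.pos y)
    refine hxy ⟨?_, ?_⟩
    · rw [Bool.eq_iff_iff]
      exact ⟨fun h' => (hx.1 ⟨h', le_rfl⟩).1, fun h' => (hy.2 ⟨h', le_rfl⟩).1⟩
    · intro h'
      have h1 := hx.1 ⟨h', le_rfl⟩
      exact le_antisymm (hy.2 ⟨h1.1, le_rfl⟩).2 h1.2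
  have hentry : ∀ (e f : {q : Fin N × Fin N // q.1 < q.2 ∧ adj q.1 q.2 ∧ ce q.1 q.2 ≠ c0})
      (i : Fin (ml (ce e.1.1 e.1.2) + 1)) (j : Fin (ml (ce f.1.1 f.1.2) + 1)),
      (i : ℕ) = (j : ℕ) → u (Sum.inr ⟨e, i⟩) (Sum.inr ⟨f, j⟩) = pathEntry u e f i := by
    rintro e f ⟨i, hi⟩ ⟨j, hj⟩ hij
    obtain rfl : i = j := hij
    rw [pathEntry, dif_pos ⟨hi, hj⟩]
  have hdown : ∀ (e f : {q : Fin N × Fin N // q.1 < q.2 ∧ adj q.1 q.2 ∧ ce q.1 q.2 ≠ c0})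
      (i : Fin (ml (ce e.1.1 e.1.2) + 1)) (j : Fin (ml (ce f.1.1 f.1.2) + 1)),
      (i : ℕ) = (j : ℕ) →
        u (Sum.inr ⟨e, i⟩) (Sum.inr ⟨f, j⟩) = u (Sum.inr ⟨e, 0⟩) (Sum.inr ⟨f, 0⟩) := by
    intro e f i j hij
    rw [hentry e f i j hij, hentry e f 0 0 rfl,
      pathEntry_eq_pathEntry_zero hblock e f hcomm (Nat.le_of_lt_succ i.2)]
    rfl
  obtain ⟨hs, hi, hrow, hcol⟩ := hmu
  have horth : ∀ x y z, y ≠ z → u x y * u x z = 0 := fun x y z h =>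
    mul_eq_zero_of_projections_sum_eq_one (hs x) (hi x) (hrow x) h
  have horth' : ∀ x y z, x ≠ y → u x z * u y z = 0 := fun x y z h =>
    mul_eq_zero_of_projections_sum_eq_one (p := fun x => u x z) (fun x => hs x z)
      (fun x => hi x z) (hcol z) h
  have hends : ∀ e : {q : Fin N × Fin N // q.1 < q.2 ∧ adj q.1 q.2 ∧ ce q.1 q.2 ≠ c0},
      (Sum.inl ⟨e.1.1, 0⟩ : DVert N cV pl adj ce c0 ml) ≠ Sum.inl ⟨e.1.2, 0⟩ := by
    intro e h
    have := congrArg DVert.root h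
    simp only [DVert.root, Sum.inl.injEq] at this
    exact e.2.1.ne this
  refine ⟨⟨fun x e => ⟨hblock _ _ (by simp), hblock _ _ (by simp)⟩, fun e f h => hblock _ _ ?_⟩,
    hdown, ?_, ?_⟩
  · simpa [DVert.pos] using h
  · intro e f i j hij hne
    rw [hentry e f i j hij, pathEntry_eq_zero hblock e f hcomm]
    exact fun h => hne (hml _ _ e.2.2.2 f.2.2.2 h)
  · intro e f i j hij _
    rw [hdown e f i j hij]
    refine add_mul_add_eq_of_orthogonal (hs _ _) (hs _ _) (hs _ _) (hs _ _) (hs _ _)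
      (horth _ _ _ (hends f)) (horth _ _ _ (hends f)) (horth' _ _ _ (hends e)) (hi _ _) ?_
    rw [← sum_mul_adjDMat_inl hblock e hcomm, ← sum_mul_adjDMat_inl hblock e hcomm,
      sum_mul_adjDMat_mul_sum_mul_adjDMat hblock e f hi horth]
end

section
/- Let G be a finite edge-colored graph and let c be an edge color whose color class is a perfect matching, i.e., every vertex of G is incident to exactly one edge of color c. Let u be a magic unitary over a unital C*-algebra indexed by V(G) with A_{G_c} u = u A_{G_c}, where A_{G_c} is the 0/1 adjacency matrix of the edges of color c. Then for all edges (i,k) and (j,l) of color c, one has u_{ij} u_{kl} = u_{ij} and u_{ij} u_{kl} = u_{kl} u_{ij}. -/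
open scoped BigOperators

/-- Entries of a matrix commuting with the adjacency matrix of a perfect matching agree along
matched pairs of indices. -/
theorem entry_eq_of_commute_perfectMatching
    {V R : Type*} [Fintype V] [NonAssocSemiring R] (E : V → V → Prop) [DecidableRel E]
    (hsymm : ∀ v w, E v w → E w v) (hpm : ∀ v : V, ∃! w : V, E v w) (u : V → V → R)
    (hcomm : ∀ v w : V,
      (∑ x, (if E v x then (1 : R) else 0) * u x w)
        = ∑ x, u v x * (if E x w then (1 : R) else 0))
    {i k j l : V} (hik : E i k) (hjl : E j l) : u k l = u i j := by
  have h := hcomm i l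
  rwa [Finset.sum_eq_single k
      (fun x _ hx => by rw [if_neg fun hix => hx ((hpm i).unique hix hik), zero_mul])
      (fun hk => absurd (Finset.mem_univ k) hk),
    Finset.sum_eq_single j
      (fun x _ hx => by
        rw [if_neg fun hxl => hx ((hpm l).unique (hsymm x l hxl) (hsymm j l hjl)), mul_zero])
      (fun hj => absurd (Finset.mem_univ j) hj),
    if_pos hik, if_pos hjl, one_mul, mul_one] at h

/-- If the color class `E` of an edge color of a finite edge-colored graph is a perfect
matching and the magic unitary `u` commutes with its adjacency matrix, then for all
edges `(i,k)` and `(j,l)` of this color one has `u_{ij} u_{kl} = u_{ij}` and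
`u_{ij} u_{kl} = u_{kl} u_{ij}`. -/
theorem perfectMatchingColorCommutation
    {V A : Type*} [Fintype V]
    [NormedRing A] [StarRing A] [CStarRing A] [NormedAlgebra ℂ A] [CompleteSpace A]
    (E : V → V → Prop) [DecidableRel E]
    (hsymm : ∀ v w, E v w → E w v) (hirr : ∀ v, ¬ E v v)
    (hpm : ∀ v : V, ∃! w : V, E v w)
    (u : V → V → A) (hmu : IsMagicUnitary u)
    (hcomm : ∀ v w : V,
      (∑ x, (if E v x then (1 : A) else 0) * u x w)
        = ∑ x, u v x * (if E x w then (1 : A) else 0)) :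
    ∀ i k j l : V, E i k → E j l →
      u i j * u k l = u i j ∧ u i j * u k l = u k l * u i j := by
  intro i k j l hik hjl
  rw [entry_eq_of_commute_perfectMatching E hsymm hpm u hcomm hik hjl]
  exact ⟨hmu.2.1 i j, rfl⟩
end

section
/- Let M ∈ F_2^{m×n} and b ∈ F_2^m with b ≠ 0. Suppose there exist a unital C*-algebra A with 1 ≠ 0 and elements x_1,…,x_n ∈ A such that x_i* = x_i and x_i² = 1 for all i, x_i x_j = x_j x_i whenever i,j ∈ S_k for some k ∈ [m], and ∏_{i∈S_k} x_i = (−1)^{b_k}·1 for every k ∈ [m] (product in increasing order of indices). Then in the solution group Γ(M,b), the element γ is not equal to the identity. -/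
open scoped BigOperators

/-- `S_k = {i : M k i = 1}`. -/
def Sk {m n : ℕ} (M : Matrix (Fin m) (Fin n) (ZMod 2)) (k : Fin m) : Finset (Fin n) :=
  Finset.univ.filter fun i => M k i = 1

/-- The relators of the solution group `Γ(M,b)`: generators are `some i = x_i`
(`i ∈ [n]`) and `none = γ`; the relators are `x_i²`, the commutators `[x_i, x_j]` for
`i, j ∈ S_k`, the relators `(∏_{i ∈ S_k} x_i) γ^{-b_k}` (product in increasing order of
indices), `γ²`, and the commutators `[x_i, γ]`. -/
def solutionGroupRels {m n : ℕ} (M : Matrix (Fin m) (Fin n) (ZMod 2))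
    (b : Fin m → ZMod 2) : Set (FreeGroup (Option (Fin n))) :=
  (Set.range fun i : Fin n => (FreeGroup.of (some i)) ^ 2) ∪
  {r | ∃ k : Fin m, ∃ i j : Fin n, M k i = 1 ∧ M k j = 1 ∧
      r = FreeGroup.of (some i) * FreeGroup.of (some j) *
        (FreeGroup.of (some i))⁻¹ * (FreeGroup.of (some j))⁻¹} ∪
  {r | ∃ k : Fin m,
      r = (((Sk M k).sort (· ≤ ·)).map fun i => FreeGroup.of (some i)).prod *
        ((FreeGroup.of (none : Option (Fin n)))⁻¹) ^ (if b k = 0 then 0 else 1)} ∪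
  {(FreeGroup.of (none : Option (Fin n))) ^ 2} ∪
  (Set.range fun i : Fin n => FreeGroup.of (some i) *
      FreeGroup.of (none : Option (Fin n)) *
      (FreeGroup.of (some i))⁻¹ * (FreeGroup.of (none : Option (Fin n)))⁻¹)

/-- The solution group `Γ(M,b)` of the linear system `Mx = b`. -/
abbrev SolutionGroup {m n : ℕ} (M : Matrix (Fin m) (Fin n) (ZMod 2))
    (b : Fin m → ZMod 2) : Type :=
  PresentedGroup (solutionGroupRels M b)

theorem neg_one_ne_one_of_algebra_complex (A : Type*) [Ring A] [Algebra ℂ A] [Nontrivial A] :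
    (-1 : A) ≠ 1 := by
  intro h
  have h2 : algebraMap ℂ A (-1) = algebraMap ℂ A 1 := by simpa using h
  have h3 : (-1 : ℂ) = 1 := FaithfulSMul.algebraMap_injective ℂ A h2
  norm_num at h3

/-- Units `u i` satisfying the relations of `Γ(M,b)` with `γ = -1` kill all the relators. -/
theorem lift_eq_one_of_mem_solutionGroupRels {m n : ℕ} (M : Matrix (Fin m) (Fin n) (ZMod 2))
    (b : Fin m → ZMod 2) {A : Type*} [Ring A] (u : Fin n → Aˣ) (hsq : ∀ i, u i ^ 2 = 1)
    (hcomm : ∀ (k : Fin m) (i j : Fin n), M k i = 1 → M k j = 1 → u i * u j = u j * u i)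
    (hprod : ∀ k : Fin m,
      (((Sk M k).sort (· ≤ ·)).map u).prod = if b k = 0 then 1 else -1) :
    ∀ r ∈ solutionGroupRels M b,
      FreeGroup.lift (fun o : Option (Fin n) => o.elim (-1) u) r = 1 := by
  rintro r ((((⟨i, rfl⟩ | ⟨k, i, j, hi, hj, rfl⟩) | ⟨k, rfl⟩) | rfl) | ⟨i, rfl⟩)
  · simp [hsq]
  · simp [hcomm k i j hi hj]
  · have h : FreeGroup.lift (fun o : Option (Fin n) => o.elim (-1) u)
        (((Sk M k).sort (· ≤ ·)).map fun i => FreeGroup.of (some i)).prod =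
        (((Sk M k).sort (· ≤ ·)).map u).prod := by
      rw [map_list_prod, List.map_map]
      congr 2
      funext i
      simp
    rw [map_mul, h, hprod]
    split_ifs <;> simp
  · simp
  · simp

/-- If the relations of `Γ(M,b)` (with `γ = -1`) admit a representation by self-adjoint
involutions `x_i` in a nontrivial unital C*-algebra — i.e. `x_i* = x_i`, `x_i² = 1`,
`x_i x_j = x_j x_i` whenever `i, j ∈ S_k`, and `∏_{i ∈ S_k} x_i = (-1)^{b_k}` (product
in increasing order) — then `γ ≠ 1` in `Γ(M,b)`. -/
theorem gammaNeOneOfRepresentation {m n : ℕ} (M : Matrix (Fin m) (Fin n) (ZMod 2))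
    (b : Fin m → ZMod 2) (hb : b ≠ 0)
    {A : Type*} [NormedRing A] [StarRing A] [CStarRing A] [NormedAlgebra ℂ A]
    [CompleteSpace A] [Nontrivial A]
    (x : Fin n → A)
    (hstar : ∀ i, star (x i) = x i) (hsq : ∀ i, x i * x i = 1)
    (hcomm : ∀ (k : Fin m) (i j : Fin n), M k i = 1 → M k j = 1 →
      x i * x j = x j * x i)
    (hprod : ∀ k : Fin m,
      (((Sk M k).sort (· ≤ ·)).map x).prod = if b k = 0 then 1 else -1) :
    (PresentedGroup.of (rels := solutionGroupRels M b) none : SolutionGroup M b) ≠ 1 := by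
  let u : Fin n → Aˣ := fun i => ⟨x i, x i, hsq i, hsq i⟩
  have hrels := lift_eq_one_of_mem_solutionGroupRels M b u
    (fun i => Units.ext (by simp [u, sq, hsq]))
    (fun k i j hi hj => Units.ext (hcomm k i j hi hj))
    (fun k => by
      refine Units.ext ?_
      have h : (((((Sk M k).sort (· ≤ ·)).map u).prod : Aˣ) : A) =
          (((Sk M k).sort (· ≤ ·)).map x).prod := by
        rw [← Units.coeHom_apply, map_list_prod, List.map_map]
        rfl
      rw [h, hprod]
      split_ifs <;> simp)
  intro hγ
  have h := congrArg (PresentedGroup.toGroup hrels) hγ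
  rw [PresentedGroup.toGroup.of, map_one] at h
  exact neg_one_ne_one_of_algebra_complex A (by simpa using congrArg Units.val h)
end
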